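/- Let n ≥ 2 and for each natural number L let a(L) denote the (finite) number of fully commutative involutions of Coxeter length L in the affine Coxeter group of type B̃_{n+1}. Then the sequence (a(L)) is ultimately periodic with period dividing (2n+1)(2n+2): there exists N such that a(L + (2n+1)(2n+2)) = a(L) for all L ≥ N. -/

import Mathlib

open CoxeterSystem

/-- A single commutation move: transposition of two adjacent letters `a`, `b`
with `M a b = 2`. -/
def CommMove {B : Type*} (M : CoxeterMatrix B) (w w' : List B) : Prop :=
  ∃ (u v : List B) (a b : B), M a b = 2 ∧ w = u ++ a :: b :: v ∧ w' = u ++ b :: a :: v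

/-- Commutation equivalence of words: two words are commutation-equivalent if one can be
obtained from the other by a sequence of transpositions of adjacent commuting letters. -/
def CommEquiv {B : Type*} (M : CoxeterMatrix B) : List B → List B → Prop :=
  Relation.EqvGen (CommMove M)

/-- An element is fully commutative if all its reduced words are commutation-equivalent. -/
def IsFullyCommutative {B W : Type*} [Group W] {M : CoxeterMatrix B}
    (cs : CoxeterSystem M W) (w : W) : Prop :=
  ∀ u v : List B, cs.IsReduced u → cs.wordProd u = w →
    cs.IsReduced v → cs.wordProd v = w → CommEquiv M u v

/-- A fully commutative involution (the identity is allowed). -/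
def IsFCInvolution {B W : Type*} [Group W] {M : CoxeterMatrix B}
    (cs : CoxeterSystem M W) (w : W) : Prop :=
  IsFullyCommutative cs w ∧ w * w = 1

/-- The Coxeter matrix of affine type `B̃_{n+1}` (for `n ≥ 2`): the `n + 2` generators
`u, s_1, …, s_n, s_{n+1}` are indexed by `Fin (n+2)`, with index `0` corresponding to `u`
and index `k` to `s_k` for `1 ≤ k ≤ n+1`. Here `u, s_1, …, s_{n-1}` form a path with
`m(u, s_1) = 4` and `m(s_i, s_{i+1}) = 3` for `1 ≤ i ≤ n-2`; the end vertex `s_{n-1}` is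
joined to the fork vertices `s_n`, `s_{n+1}` with `m(s_{n-1}, s_n) = m(s_{n-1}, s_{n+1}) = 3`
and `m(s_n, s_{n+1}) = 2`; and `m = 2` for all other pairs of distinct generators. -/
def affineB (n : ℕ) : CoxeterMatrix (Fin (n + 2)) where
  M := Matrix.of fun i j : Fin (n + 2) =>
    if (i : ℕ) = (j : ℕ) then 1
    else if ((i : ℕ) = 0 ∧ (j : ℕ) = 1) ∨ ((j : ℕ) = 0 ∧ (i : ℕ) = 1) then 4
    else if ((i : ℕ) + 1 = (j : ℕ) ∧ (j : ℕ) ≤ n) ∨ ((j : ℕ) + 1 = (i : ℕ) ∧ (i : ℕ) ≤ n)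
        ∨ ((i : ℕ) + 2 = n + 1 ∧ (j : ℕ) = n + 1)
        ∨ ((j : ℕ) + 2 = n + 1 ∧ (i : ℕ) = n + 1) then 3
    else 2
  isSymm := by
    ext i j
    simp only [Matrix.transpose_apply, Matrix.of_apply]
    split_ifs <;> omega
  diagonal := by intro i; simp [Matrix.of_apply]
  off_diagonal := by
    intro i j hij
    have h : (i : ℕ) ≠ (j : ℕ) := fun h => hij (Fin.ext h)
    simp only [Matrix.of_apply]
    split_ifs <;> omega

/-- The subword of `w` consisting of the occurrences of `s` and `t`. -/
abbrev pairFilter {B : Type*} [DecidableEq B] (s t : B) (w : List B) : List B :=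
  w.filter fun b => b = s ∨ b = t

namespace CommEquiv

variable {B : Type*} {M : CoxeterMatrix B} {w w' w'' : List B}

theorem refl (w : List B) : CommEquiv M w w := Relation.EqvGen.refl w

theorem symm (h : CommEquiv M w w') : CommEquiv M w' w := Relation.EqvGen.symm _ _ h

theorem trans (h : CommEquiv M w w') (h' : CommEquiv M w' w'') : CommEquiv M w w'' :=
  Relation.EqvGen.trans _ _ _ h h'

theorem append_left (x : List B) (h : CommEquiv M w w') : CommEquiv M (x ++ w) (x ++ w') := by
  induction h with
  | rel _ _ h =>
    obtain ⟨u, v, a, b, hab, rfl, rfl⟩ := h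
    exact Relation.EqvGen.rel _ _ ⟨x ++ u, v, a, b, hab, by simp, by simp⟩
  | refl => exact refl _
  | symm _ _ _ ih => exact ih.symm
  | trans _ _ _ _ _ ih ih' => exact ih.trans ih'

theorem cons (s : B) (h : CommEquiv M w w') : CommEquiv M (s :: w) (s :: w') :=
  h.append_left [s]

theorem cons_append_of_commute {s : B} {y : List B} (h : ∀ b ∈ y, M s b = 2) (z : List B) :
    CommEquiv M (s :: (y ++ z)) (y ++ s :: z) := by
  induction y with
  | nil => exact refl _
  | cons b y ih =>
    have h₁ : CommEquiv M (s :: b :: (y ++ z)) (b :: s :: (y ++ z)) :=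
      Relation.EqvGen.rel _ _ ⟨[], y ++ z, s, b, h b (by simp), rfl, rfl⟩
    exact h₁.trans ((ih fun c hc => h c (by simp [hc])).cons b)

theorem perm (h : CommEquiv M w w') : w.Perm w' := by
  induction h with
  | rel _ _ h =>
    obtain ⟨u, v, a, b, -, rfl, rfl⟩ := h
    exact (List.Perm.swap b a v).append_left u
  | refl => exact List.Perm.refl _
  | symm _ _ _ ih => exact ih.symm
  | trans _ _ _ _ _ ih ih' => exact ih.trans ih'

theorem wordProd_eq {W : Type*} [Group W] (cs : CoxeterSystem M W) (h : CommEquiv M w w') :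
    cs.wordProd w = cs.wordProd w' := by
  induction h with
  | rel _ _ h =>
    obtain ⟨u, v, a, b, hab, rfl, rfl⟩ := h
    have := cs.wordProd_braidWord_eq a b
    have hba : M b a = 2 := by rw [M.symmetric, hab]
    simp only [braidWord, hab, hba, alternatingWord, List.concat_eq_append, List.nil_append,
      List.cons_append, cs.wordProd_cons, cs.wordProd_nil, mul_one] at this
    simp only [cs.wordProd_append, cs.wordProd_cons, ← mul_assoc (cs.simple a),
      ← mul_assoc (cs.simple b), this]
  | refl => rfl
  | symm _ _ _ ih => exact ih.symm
  | trans _ _ _ _ _ ih ih' => exact ih.trans ih'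

theorem isReduced {W : Type*} [Group W] {cs : CoxeterSystem M W} (h : CommEquiv M w w')
    (hw : cs.IsReduced w) : cs.IsReduced w' := by
  rw [CoxeterSystem.IsReduced, ← h.wordProd_eq cs, ← h.perm.length_eq]
  exact hw

theorem pairFilter_eq [DecidableEq B] {s t : B} (hst : M s t ≠ 2) (h : CommEquiv M w w') :
    pairFilter s t w = pairFilter s t w' := by
  induction h with
  | rel _ _ h =>
    obtain ⟨u, v, a, b, hab, rfl, rfl⟩ := h
    have hba : M b a = 2 := by rw [M.symmetric, hab]
    have hne : a ≠ b := by
      rintro rfl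
      simp at hab
    by_cases ha : a = s ∨ a = t <;> by_cases hb : b = s ∨ b = t
    · rcases ha with rfl | rfl <;> rcases hb with rfl | rfl <;> contradiction
    all_goals simp [ha, hb]
  | refl => rfl
  | symm _ _ _ ih => exact ih.symm
  | trans _ _ _ _ _ ih ih' => exact ih.trans ih'

/-- Words with the same projections to all pairs of non-commuting letters are
commutation-equivalent. -/
theorem of_pairFilter_eq [DecidableEq B]
    (h : ∀ s t, M s t ≠ 2 → pairFilter s t w = pairFilter s t w') : CommEquiv M w w' := by
  induction w generalizing w' with
  | nil =>
    have : w' = [] := List.eq_nil_iff_forall_not_mem.2 fun a ha => by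
      have := h a a (by simp)
      have hm : a ∈ pairFilter a a w' := by simp [ha]
      rw [← this] at hm
      simp at hm
    rw [this]
    exact refl _
  | cons a w ih =>
    have ha : a ∈ w' := by
      have hm : a ∈ pairFilter a a (a :: w) := by simp
      rw [h a a (by simp)] at hm
      exact List.mem_of_mem_filter hm
    obtain ⟨y, z, rfl, hy⟩ := List.eq_append_cons_of_mem ha
    have hcomm : ∀ b ∈ y, M a b = 2 := by
      by_contra! hcon
      obtain ⟨b, hb, hab⟩ := hcon
      have hf := h a b hab
      rw [pairFilter, pairFilter, List.filter_cons_of_pos (by simp), List.filter_append] at hf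
      cases hc : List.filter (fun c => decide (c = a ∨ c = b)) y with
      | nil =>
        have : b ∈ List.filter (fun c => decide (c = a ∨ c = b)) y :=
          List.mem_filter.2 ⟨hb, by simp⟩
        rw [hc] at this
        exact List.not_mem_nil this
      | cons d l =>
        rw [hc] at hf
        have hd : d ∈ List.filter (fun c => decide (c = a ∨ c = b)) y :=
          hc ▸ List.mem_cons_self
        have : a = d := by simpa using (List.cons.inj hf).1
        exact hy (this ▸ List.mem_of_mem_filter hd)
    have hmove : CommEquiv M (a :: (y ++ z)) (y ++ a :: z) := cons_append_of_commute hcomm z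
    refine (cons a (ih fun s t hst => ?_)).trans hmove
    have hf := h s t hst
    rw [← hmove.pairFilter_eq hst] at hf
    by_cases has : a = s ∨ a = t
    · simpa [pairFilter, has] using hf
    · simpa [pairFilter, has] using hf

end CommEquiv

section FullyCommutative

variable {B W : Type*} [Group W] {M : CoxeterMatrix B} {cs : CoxeterSystem M W} {w : List B}

theorem CommEquiv.ne_of_isReduced (hw : cs.IsReduced w) {u v : List B} {s : B} :
    ¬ CommEquiv M w (u ++ s :: s :: v) := by
  intro h
  have h₁ := h.isReduced hw
  rw [CoxeterSystem.IsReduced] at h₁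
  have h₂ : cs.wordProd (u ++ s :: s :: v) = cs.wordProd (u ++ v) := by
    simp [cs.wordProd_append, cs.wordProd_cons]
  have h₃ := cs.length_wordProd_le (u ++ v)
  rw [h₂] at h₁
  simp only [List.length_append, List.length_cons] at h₁ h₃
  omega

theorem CommEquiv.of_isFullyCommutative (hw : cs.IsReduced w)
    (hfc : IsFullyCommutative cs (cs.wordProd w)) {x y : List B} (h : CommEquiv M w x)
    (hprod : cs.wordProd x = cs.wordProd y) (hlen : x.length = y.length) : CommEquiv M x y := by
  have hx := h.isReduced hw
  refine hfc x y hx (h.wordProd_eq cs).symm ?_ (hprod ▸ (h.wordProd_eq cs).symm)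
  rw [CoxeterSystem.IsReduced, ← hprod, ← hlen]
  exact hx

theorem CommEquiv.ne_of_eq_three (hw : cs.IsReduced w)
    (hfc : IsFullyCommutative cs (cs.wordProd w)) {u v : List B} {s t : B} (hst : M s t = 3) :
    ¬ CommEquiv M w (u ++ s :: t :: s :: v) := by
  classical
  intro h
  have hts : M t s = 3 := by rw [M.symmetric, hst]
  have hne : s ≠ t := by
    rintro rfl
    simp at hst
  have hb := cs.wordProd_braidWord_eq s t
  simp only [braidWord, hst, hts, alternatingWord, List.concat_eq_append, List.nil_append,
    List.cons_append, cs.wordProd_cons, cs.wordProd_nil, mul_one] at hb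
  have h₁ := (CommEquiv.of_isFullyCommutative hw hfc h (y := u ++ t :: s :: t :: v)
    (by
      have hb' := congrArg (fun g => cs.wordProd u * (g * cs.wordProd v)) hb.symm
      simpa only [cs.wordProd_append, cs.wordProd_cons, mul_assoc] using hb')
    (by simp)).perm.count_eq s
  simp [List.count_append, hne.symm] at h₁

theorem CommEquiv.ne_of_eq_four (hw : cs.IsReduced w)
    (hfc : IsFullyCommutative cs (cs.wordProd w)) {u v : List B} {s t : B} (hst : M s t = 4) :
    ¬ CommEquiv M w (u ++ s :: t :: s :: t :: v) := by
  classical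
  intro h
  have hts : M t s = 4 := by rw [M.symmetric, hst]
  have hne : s ≠ t := by
    rintro rfl
    simp at hst
  have hb := cs.wordProd_braidWord_eq s t
  simp only [braidWord, hst, hts, alternatingWord, List.concat_eq_append, List.nil_append,
    List.cons_append, cs.wordProd_cons, cs.wordProd_nil, mul_one] at hb
  have h₁ := (CommEquiv.of_isFullyCommutative hw hfc h (y := u ++ t :: s :: t :: s :: v)
    (by
      have hb' := congrArg (fun g => cs.wordProd u * (g * cs.wordProd v)) hb
      simpa only [cs.wordProd_append, cs.wordProd_cons, mul_assoc] using hb')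
    (by simp)).pairFilter_eq (s := s) (t := t) (by omega)
  simp [hne] at h₁

theorem List.drop_eq_append_cons {w : List B} {k x : ℕ} {a : B} (hkx : k ≤ x)
    (hx : w[x]? = some a) : ∃ y : List B, w.drop k = y ++ a :: w.drop (x + 1) ∧
      ∀ b ∈ y, ∃ z, k ≤ z ∧ z < x ∧ w[z]? = some b := by
  refine ⟨(w.drop k).take (x - k), ?_, fun b hb => ?_⟩
  · obtain ⟨hlt, rfl⟩ := List.getElem?_eq_some_iff.1 hx
    rw [← List.drop_eq_getElem_cons hlt]
    conv_lhs => rw [← List.take_append_drop (x - k) (w.drop k)]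
    rw [List.drop_drop, Nat.add_sub_cancel' hkx]
  · obtain ⟨i, hi, rfl⟩ := List.getElem_of_mem hb
    simp only [List.length_take, List.length_drop] at hi
    refine ⟨k + i, by omega, by omega, ?_⟩
    simp only [List.getElem_take, List.getElem_drop]
    exact List.getElem?_eq_getElem _

theorem IsFullyCommutative.not_consecutive (hw : cs.IsReduced w) {s : B} {x y : ℕ} (hxy : x < y)
    (hx : w[x]? = some s) (hy : w[y]? = some s)
    (h : ∀ z a, x < z → z < y → w[z]? = some a → M s a = 2) : False := by
  obtain ⟨u, hu, -⟩ := List.drop_eq_append_cons (Nat.zero_le x) hx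
  obtain ⟨v, hv, hv'⟩ := List.drop_eq_append_cons (Nat.succ_le_of_lt hxy) hy
  rw [List.drop_zero, hv] at hu
  have hc : ∀ b ∈ v, M s b = 2 := fun b hb => by
    obtain ⟨z, hz, hz', hz''⟩ := hv' b hb
    exact h z b hz hz' hz''
  refine CommEquiv.ne_of_isReduced hw (u := u ++ v) (s := s) (v := w.drop (y + 1)) ?_
  have := (CommEquiv.cons_append_of_commute hc (s :: w.drop (y + 1))).append_left u
  rw [← hu] at this
  simpa using this

theorem IsFullyCommutative.not_braid_three (hw : cs.IsReduced w)
    (hfc : IsFullyCommutative cs (cs.wordProd w)) {s t : B} (hst : M s t = 3) {x y z : ℕ}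
    (hxy : x < y) (hyz : y < z) (hx : w[x]? = some s) (hy : w[y]? = some t)
    (hz : w[z]? = some s)
    (h : ∀ k a, x < k → k < z → k ≠ y → w[k]? = some a → M s a = 2) : False := by
  obtain ⟨u, hu, -⟩ := List.drop_eq_append_cons (Nat.zero_le x) hx
  obtain ⟨v, hv, hv'⟩ := List.drop_eq_append_cons (Nat.succ_le_of_lt hxy) hy
  obtain ⟨r, hr, hr'⟩ := List.drop_eq_append_cons (Nat.succ_le_of_lt hyz) hz
  rw [List.drop_zero, hv, hr] at hu
  have hc : ∀ b ∈ v, M s b = 2 := fun b hb => by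
    obtain ⟨k, hk, hk', hk''⟩ := hv' b hb
    exact h k b hk (by omega) (by omega) hk''
  have hc' : ∀ b ∈ r, M s b = 2 := fun b hb => by
    obtain ⟨k, hk, hk', hk''⟩ := hr' b hb
    exact h k b (by omega) hk' (by omega) hk''
  refine CommEquiv.ne_of_eq_three hw hfc hst (u := u ++ v) (v := r ++ w.drop (z + 1)) ?_
  have h₁ := (CommEquiv.cons_append_of_commute hc
    (t :: (r ++ s :: w.drop (z + 1)))).append_left u
  have h₂ := (CommEquiv.cons_append_of_commute hc' (w.drop (z + 1))).symm.append_left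
    (u ++ v ++ [s, t])
  rw [← hu] at h₁
  exact h₁.trans (by simpa using h₂)

theorem IsFullyCommutative.not_braid_four (hw : cs.IsReduced w)
    (hfc : IsFullyCommutative cs (cs.wordProd w)) {s t : B} (hst : M s t = 4) {x y z r : ℕ}
    (hxy : x < y) (hyz : y < z) (hzr : z < r) (hx : w[x]? = some s) (hy : w[y]? = some t)
    (hz : w[z]? = some s) (hr : w[r]? = some t)
    (h : ∀ k a, x < k → k < z → k ≠ y → w[k]? = some a → M s a = 2)
    (h' : ∀ k a, y < k → k < r → k ≠ z → w[k]? = some a → M t a = 2) : False := by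
  obtain ⟨u, hu, -⟩ := List.drop_eq_append_cons (Nat.zero_le x) hx
  obtain ⟨a, ha, ha'⟩ := List.drop_eq_append_cons (Nat.succ_le_of_lt hxy) hy
  obtain ⟨b, hb, hb'⟩ := List.drop_eq_append_cons (Nat.succ_le_of_lt hyz) hz
  obtain ⟨c, hc, hc'⟩ := List.drop_eq_append_cons (Nat.succ_le_of_lt hzr) hr
  rw [List.drop_zero, ha, hb, hc] at hu
  have hsa : ∀ e ∈ a, M s e = 2 := fun e he => by
    obtain ⟨k, hk, hk', hk''⟩ := ha' e he
    exact h k e hk (by omega) (by omega) hk''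
  have hsb : ∀ e ∈ b, M s e = 2 := fun e he => by
    obtain ⟨k, hk, hk', hk''⟩ := hb' e he
    exact h k e (by omega) hk' (by omega) hk''
  have htb : ∀ e ∈ b, M t e = 2 := fun e he => by
    obtain ⟨k, hk, hk', hk''⟩ := hb' e he
    exact h' k e hk (by omega) (by omega) hk''
  have htc : ∀ e ∈ c, M t e = 2 := fun e he => by
    obtain ⟨k, hk, hk', hk''⟩ := hc' e he
    exact h' k e (by omega) hk' (by omega) hk''
  refine CommEquiv.ne_of_eq_four hw hfc hst (u := u ++ a ++ b) (v := c ++ w.drop (r + 1)) ?_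
  have h₁ := (CommEquiv.cons_append_of_commute hsa
    (t :: (b ++ s :: (c ++ t :: w.drop (r + 1))))).append_left u
  rw [← hu] at h₁
  have h₂ := (CommEquiv.cons_append_of_commute htb
    (s :: (c ++ t :: w.drop (r + 1)))).append_left (u ++ a ++ [s])
  have h₃ := (CommEquiv.cons_append_of_commute hsb
    (t :: s :: (c ++ t :: w.drop (r + 1)))).append_left (u ++ a)
  have h₄ := (CommEquiv.cons_append_of_commute htc (w.drop (r + 1))).symm.append_left
    (u ++ a ++ b ++ [s, t, s])
  simp only [List.append_assoc, List.cons_append, List.nil_append] at h₁ h₂ h₃ h₄ ⊢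
  exact ((h₁.trans h₂).trans h₃).trans h₄

end FullyCommutative

section Windows

variable {B : Type*} [DecidableEq B]

/-- Every window of `p` consecutive letters of `l` contains the letter `s` exactly `c` times. -/
def HasUniformWindows (l : List B) (s : B) (p c : ℕ) : Prop :=
  ∀ f : List B, f <:+: l → f.length = p → f.count s = c

theorem HasUniformWindows.mono {l l' : List B} {s : B} {p c : ℕ} (h : HasUniformWindows l s p c)
    (hl : l' <:+: l) : HasUniformWindows l' s p c :=
  fun f hf => h f (hf.trans hl)

theorem HasUniformWindows.mul {l : List B} {s : B} {p c : ℕ} (h : HasUniformWindows l s p c)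
    (k : ℕ) : HasUniformWindows l s (k * p) (k * c) := by
  induction k with
  | zero =>
    intro f _ hf
    simp only [zero_mul, List.length_eq_zero_iff] at hf ⊢
    simp [hf]
  | succ k ih =>
    intro f hf hlen
    have hlen' : f.length = k * p + p := by rw [hlen]; ring
    rw [← List.take_append_drop (k * p) f, List.count_append,
      ih _ ((List.take_prefix _ _).isInfix.trans hf) (by rw [List.length_take]; omega),
      h _ ((List.drop_suffix _ _).isInfix.trans hf) (by rw [List.length_drop]; omega)]
    ring

theorem List.count_add_count_of_forall {l : List B} {s t : B} (hst : s ≠ t)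
    (hl : ∀ b ∈ l, b = s ∨ b = t) : l.count s + l.count t = l.length := by
  induction l with
  | nil => rfl
  | cons a l ih =>
    have := ih fun b hb => hl b (by simp [hb])
    rcases hl a (by simp) with rfl | rfl
    · simp [hst]
      omega
    · simp [hst.symm]
      omega

theorem HasUniformWindows.swap {l : List B} {s t : B} (hst : s ≠ t)
    (hl : ∀ b ∈ l, b = s ∨ b = t) {c d : ℕ} (h : HasUniformWindows l s (c + d) c) :
    HasUniformWindows l t (d + c) d := by
  intro f hf hlen
  have h₁ := h f hf (by omega)
  have h₂ := List.count_add_count_of_forall hst fun b hb => hl b (hf.subset hb)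
  omega

theorem HasUniformWindows.drop_eq_take {l : List B} {s t : B}
    (hl : ∀ b ∈ l, b = s ∨ b = t) {p c : ℕ} (h : HasUniformWindows l s p c) :
    l.drop p = l.take (l.length - p) := by
  refine List.ext_getElem (by simp) fun k hk _ => ?_
  rw [List.length_drop] at hk
  rw [List.getElem_drop, List.getElem_take]
  have hpk : p + k < l.length := by omega
  have hk' : k < l.length := by omega
  set g := (l.drop (k + 1)).take p with hg
  have hglen : g.length = p := by rw [hg, List.length_take, List.length_drop]; omega
  set f := (l.drop k).take p with hf
  have hflen : f.length = p := by rw [hf, List.length_take, List.length_drop]; omega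
  have h₁ := h f ((List.take_prefix _ _).isInfix.trans (List.drop_suffix _ _).isInfix) hflen
  have h₂ := h g ((List.take_prefix _ _).isInfix.trans (List.drop_suffix _ _).isInfix) hglen
  have hfg : l[k] :: g = f ++ [l[p + k]] := by
    have e₁ : l[k] :: g = (l.drop k).take (p + 1) := by
      rw [List.drop_eq_getElem_cons hk', List.take_succ_cons]
    rw [e₁, List.take_add_one, List.getElem?_drop, List.getElem?_eq_getElem (by omega)]
    simp [hf, Nat.add_comm]
  have h₃ := congrArg (List.count s) hfg
  simp only [List.count_cons, List.count_append, List.count_nil, h₁, h₂] at h₃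
  have h₄ : l[k] = s ↔ l[p + k] = s := by
    by_cases ha : l[k] = s <;> by_cases hb : l[p + k] = s <;> simp [ha, hb] at h₃ ⊢
  rcases hl _ (List.getElem_mem hk') with ha | ha <;>
    rcases hl _ (List.getElem_mem hpk) with hb | hb
  · rw [ha, hb]
  · rw [h₄.1 ha, ha]
  · rw [h₄.2 hb, hb]
  · rw [ha, hb]

theorem HasUniformWindows.ext {l l' : List B} {s t : B}
    (hl : ∀ b ∈ l, b = s ∨ b = t) (hl' : ∀ b ∈ l', b = s ∨ b = t) {p c : ℕ}
    (h : HasUniformWindows l s p c) (h' : HasUniformWindows l' s p c)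
    (hlen : 2 * p ≤ l.length) (hlen' : 2 * p ≤ l'.length)
    (heq : l.take (l.length - p) = l'.take (l'.length - p)) : l = l' := by
  have key : ∀ m : List B, 2 * p ≤ m.length → m.take p = (m.take (m.length - p)).take p :=
    fun m hm => by rw [List.take_take, min_eq_left (by omega)]
  rw [← List.take_append_drop p l, ← List.take_append_drop p l', h.drop_eq_take hl,
    h'.drop_eq_take hl', key l hlen, key l' hlen', heq]

theorem HasUniformWindows.reverse_take {l : List B} {s t : B}
    (hl : ∀ b ∈ l, b = s ∨ b = t) {p c : ℕ} (h : HasUniformWindows l s p c)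
    (hlen : p ≤ l.length) (hrev : l.reverse = l) :
    (l.take (l.length - p)).reverse = l.take (l.length - p) := by
  rw [List.reverse_take, hrev, Nat.sub_sub_self hlen, h.drop_eq_take hl]

/-- The subword formed by the first `K s` occurrences of each letter `s`. -/
def List.keepFirst : (B → ℕ) → List B → List B
  | _, [] => []
  | K, a :: w => if 0 < K a then a :: keepFirst (Function.update K a (K a - 1)) w
      else keepFirst K w

/-- The subword left over after removing the first `K s` occurrences of each letter `s`. -/
def List.dropFirst : (B → ℕ) → List B → List B
  | _, [] => []
  | K, a :: w => if 0 < K a then dropFirst (Function.update K a (K a - 1)) w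
      else a :: dropFirst K w

theorem List.pairFilter_keepFirst {s t : B} (hst : s ≠ t) (w : List B) (K : B → ℕ)
    {l₁ l₂ : List B} (h : pairFilter s t w = l₁ ++ l₂) (hs : l₁.count s = K s)
    (ht : l₁.count t = K t) :
    pairFilter s t (w.keepFirst K) = l₁ ∧ pairFilter s t (w.dropFirst K) = l₂ := by
  induction w generalizing K l₁ l₂ with
  | nil =>
    have h' : l₁ = [] ∧ l₂ = [] := by simpa using h.symm
    simp [keepFirst, dropFirst, h'.1, h'.2]
  | cons a w ih =>
    by_cases ha : a = s ∨ a = t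
    · rw [pairFilter, List.filter_cons_of_pos (by simpa using ha)] at h
      rcases l₁ with _ | ⟨b, l₁⟩
      · have hK : K a = 0 := by
          rcases ha with rfl | rfl
          · simpa using hs.symm
          · simpa using ht.symm
        have hl : l₂ = a :: pairFilter s t w := h.symm
        obtain ⟨h₁, h₂⟩ := ih K (l₁ := []) (l₂ := pairFilter s t w) rfl hs ht
        simp only [keepFirst, dropFirst, hK, lt_irrefl, if_false]
        refine ⟨h₁, ?_⟩
        rw [pairFilter, List.filter_cons_of_pos (by simpa using ha), hl, ← h₂]
      · obtain ⟨rfl, h'⟩ := List.cons.inj (h.trans (List.cons_append ..))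
        have hK : 0 < K a := by
          rcases ha with rfl | rfl
          · rw [← hs]; simp
          · rw [← ht]; simp
        obtain ⟨h₁, h₂⟩ := ih (Function.update K a (K a - 1)) h'
          (by
            rcases ha with rfl | rfl
            · rw [Function.update_self, ← hs]; simp
            · rw [Function.update_of_ne hst, ← hs]; simp [hst.symm])
          (by
            rcases ha with rfl | rfl
            · rw [Function.update_of_ne hst.symm, ← ht]; simp [hst]
            · rw [Function.update_self, ← ht]; simp)
        simp only [keepFirst, dropFirst, hK, if_true]
        refine ⟨?_, h₂⟩
        rw [pairFilter, List.filter_cons_of_pos (by simpa using ha), ← h₁]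
    · rw [pairFilter, List.filter_cons_of_neg (by simpa using ha)] at h
      obtain ⟨has, hat⟩ := not_or.1 ha
      by_cases hK : 0 < K a
      · simp only [keepFirst, dropFirst, hK, if_true]
        rw [pairFilter, List.filter_cons_of_neg (by simpa using ha)]
        exact ih _ h (by rw [Function.update_of_ne (Ne.symm has), hs])
          (by rw [Function.update_of_ne (Ne.symm hat), ht])
      · simp only [keepFirst, dropFirst, hK, if_false]
        refine ⟨(ih _ h hs ht).1, ?_⟩
        rw [pairFilter, List.filter_cons_of_neg (by simpa using ha)]
        exact (ih _ h hs ht).2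

theorem pairFilter_self_pairFilter (s t : B) (w : List B) :
    pairFilter s s (pairFilter s t w) = pairFilter s s w := by
  rw [pairFilter, pairFilter, List.filter_filter]
  refine List.filter_congr fun b _ => ?_
  by_cases hb : b = s <;> simp [hb]

theorem forall_mem_pairFilter (s t : B) (w : List B) : ∀ b ∈ pairFilter s t w, b = s ∨ b = t :=
  fun b hb => by simpa using (List.mem_filter.1 hb).2

theorem count_pairFilter_left (s t : B) (w : List B) : (pairFilter s t w).count s = w.count s :=
  List.count_filter (by simp)

theorem count_pairFilter_right (s t : B) (w : List B) : (pairFilter s t w).count t = w.count t :=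
  List.count_filter (by simp)

/-- The projections of the word `w` to pairs of distinct non-commuting letters have uniform
windows, with `c s` occurrences of `s` and `c t` occurrences of `t`. -/
def IsWindowed (M : CoxeterMatrix B) (c : B → ℕ) (w : List B) : Prop :=
  ∀ s t, s ≠ t → M s t ≠ 2 → HasUniformWindows (pairFilter s t w) s (c s + c t) (c s)

variable {M : CoxeterMatrix B} {c : B → ℕ} {w w' : List B}

theorem CommEquiv.of_pairFilter_eq_of_ne (hM : ∀ s, ∃ t, s ≠ t ∧ M s t ≠ 2)
    (h : ∀ s t, s ≠ t → M s t ≠ 2 → pairFilter s t w = pairFilter s t w') : CommEquiv M w w' := by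
  refine CommEquiv.of_pairFilter_eq fun s t hst => ?_
  by_cases hs : s = t
  · subst hs
    obtain ⟨t, hne, ht⟩ := hM s
    rw [← pairFilter_self_pairFilter s t w, ← pairFilter_self_pairFilter s t w', h s t hne ht]
  · exact h s t hs hst

theorem CommEquiv.isWindowed (h : CommEquiv M w w') (hw : IsWindowed M c w) :
    IsWindowed M c w' :=
  fun s t hst hM => h.pairFilter_eq hM ▸ hw s t hst hM

theorem IsWindowed.exists_split [Fintype B] (hM : ∀ s, ∃ t, s ≠ t ∧ M s t ≠ 2)
    (hw : IsWindowed M c w)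
    (hlong : ∀ s t, s ≠ t → M s t ≠ 2 → c s + c t ≤ (pairFilter s t w).length) :
    ∃ v r : List B, CommEquiv M w (v ++ r) ∧ r.length = ∑ s, c s ∧
      ∀ s t, s ≠ t → M s t ≠ 2 → pairFilter s t v =
        (pairFilter s t w).take ((pairFilter s t w).length - (c s + c t)) := by
  set K : B → ℕ := fun s => w.count s - c s with hK
  have hcount : ∀ s t, s ≠ t → M s t ≠ 2 →
      ((pairFilter s t w).drop ((pairFilter s t w).length - (c s + c t))).count s = c s ∧
      ((pairFilter s t w).drop ((pairFilter s t w).length - (c s + c t))).count t = c t := by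
    intro s t hst hMst
    have hlen : ((pairFilter s t w).drop
        ((pairFilter s t w).length - (c s + c t))).length = c s + c t := by
      rw [List.length_drop]
      have := hlong s t hst hMst
      omega
    have h₁ := hw s t hst hMst _ (List.drop_suffix _ _).isInfix hlen
    have h₂ := List.count_add_count_of_forall hst fun b hb =>
      forall_mem_pairFilter s t w b ((List.drop_suffix
        ((pairFilter s t w).length - (c s + c t)) _).subset hb)
    exact ⟨h₁, by omega⟩
  have hsplit : ∀ s t, s ≠ t → M s t ≠ 2 → pairFilter s t (w.keepFirst K) =
      (pairFilter s t w).take ((pairFilter s t w).length - (c s + c t)) ∧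
      pairFilter s t (w.dropFirst K) =
      (pairFilter s t w).drop ((pairFilter s t w).length - (c s + c t)) := by
    intro s t hst hMst
    obtain ⟨hs, ht⟩ := hcount s t hst hMst
    set m := (pairFilter s t w).length - (c s + c t)
    have hs' := count_pairFilter_left s t w
    have ht' := count_pairFilter_right s t w
    rw [← List.take_append_drop m (pairFilter s t w), List.count_append] at hs' ht'
    refine List.pairFilter_keepFirst hst w K (List.take_append_drop m _).symm ?_ ?_
    · simp only [hK]
      omega
    · simp only [hK]
      omega
  refine ⟨w.keepFirst K, w.dropFirst K, ?_, ?_, fun s t hst hMst => (hsplit s t hst hMst).1⟩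
  · refine CommEquiv.of_pairFilter_eq_of_ne hM fun s t hst hMst => ?_
    have := hsplit s t hst hMst
    have hsum := List.take_append_drop
      ((pairFilter s t w).length - (c s + c t)) (pairFilter s t w)
    rw [← this.1, ← this.2, ← List.filter_append] at hsum
    exact hsum.symm
  · have hcard : ∑ s, (w.dropFirst K).count s = (w.dropFirst K).length := by
      simpa using Multiset.sum_count_eq_card (s := (Finset.univ : Finset B))
        (m := (w.dropFirst K : Multiset B)) fun _ _ => Finset.mem_univ _
    rw [← hcard]
    refine Finset.sum_congr rfl fun s _ => ?_
    obtain ⟨t, hst, hMst⟩ := hM s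
    rw [← count_pairFilter_left s t, (hsplit s t hst hMst).2, (hcount s t hst hMst).1]

end Windows

section Shrinking

variable {B W : Type*} [Group W] {M : CoxeterMatrix B} (cs : CoxeterSystem M W)

theorem IsFullyCommutative.of_append [DecidableEq B] {cs : CoxeterSystem M W} {v r : List B}
    (hred : cs.IsReduced (v ++ r)) (hfc : IsFullyCommutative cs (cs.wordProd (v ++ r))) :
    cs.IsReduced v ∧ IsFullyCommutative cs (cs.wordProd v) := by
  have hv : cs.IsReduced v := by simpa using hred.take v.length
  have hext : ∀ x, cs.IsReduced x → cs.wordProd x = cs.wordProd v →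
      cs.IsReduced (x ++ r) ∧ cs.wordProd (x ++ r) = cs.wordProd (v ++ r) := by
    intro x hx hxv
    have hprod : cs.wordProd (x ++ r) = cs.wordProd (v ++ r) := by
      rw [cs.wordProd_append, cs.wordProd_append, hxv]
    have hlen : x.length = v.length := by rw [← hx.eq, ← hv.eq, hxv]
    refine ⟨?_, hprod⟩
    rw [CoxeterSystem.IsReduced, hprod, hred.eq, List.length_append, List.length_append, hlen]
  refine ⟨hv, fun x y hx hxv hy hyv => CommEquiv.of_pairFilter_eq fun s t hst => ?_⟩
  have h := (hfc _ _ (hext x hx hxv).1 (hext x hx hxv).2 (hext y hy hyv).1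
    (hext y hy hyv).2).pairFilter_eq hst
  rw [pairFilter, pairFilter, List.filter_append, List.filter_append] at h
  exact List.append_cancel_right h

/-- The fully commutative involutions of length `L`. -/
def fcInvolutions (L : ℕ) : Set W := {g | IsFCInvolution cs g ∧ cs.length g = L}

/-- The fully commutative involutions of length `L` whose reduced words have uniform windows. -/
def windowedFCInvolutions [DecidableEq B] (c : B → ℕ) (L : ℕ) : Set W :=
  {g ∈ fcInvolutions cs L | ∀ w, cs.IsReduced w → cs.wordProd w = g → IsWindowed M c w}

theorem finite_fcInvolutions [Finite B] (L : ℕ) : (fcInvolutions cs L).Finite := by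
  refine ((List.finite_length_eq B L).image cs.wordProd).subset ?_
  rintro g ⟨-, rfl⟩
  obtain ⟨w, hw, rfl⟩ := cs.exists_isReduced g
  exact ⟨w, hw.eq.symm, rfl⟩

variable {cs} in
theorem exists_shrink [DecidableEq B] [Fintype B] (hM : ∀ s, ∃ t, s ≠ t ∧ M s t ≠ 2)
    {c : B → ℕ} {L : ℕ} {g : W} (hg : g ∈ windowedFCInvolutions cs c (L + ∑ s, c s))
    (hlong : ∀ w, cs.IsReduced w → cs.wordProd w = g → ∀ s t, s ≠ t → M s t ≠ 2 →
      2 * (c s + c t) ≤ (pairFilter s t w).length) :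
    ∃ w v : List B, cs.wordProd w = g ∧ cs.IsReduced w ∧ cs.IsReduced v ∧
      cs.wordProd v ∈ windowedFCInvolutions cs c L ∧
      ∀ s t, s ≠ t → M s t ≠ 2 → pairFilter s t v =
        (pairFilter s t w).take ((pairFilter s t w).length - (c s + c t)) := by
  obtain ⟨⟨⟨hfc, hinv⟩, hlen⟩, hwin⟩ := hg
  obtain ⟨w, hw, rfl⟩ := cs.exists_isReduced g
  have hwin' := hwin w hw rfl
  have hlong' := hlong w hw rfl
  obtain ⟨v, r, hvr, hr, hv⟩ := hwin'.exists_split hM fun s t hst hMst => by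
    have := hlong' s t hst hMst
    omega
  have hred := hvr.isReduced hw
  obtain ⟨hvred, hvfc⟩ := IsFullyCommutative.of_append hred (hvr.wordProd_eq cs ▸ hfc)
  have hvwin : IsWindowed M c v := fun s t hst hMst => by
    rw [hv s t hst hMst]
    exact (hwin' s t hst hMst).mono (List.take_prefix _ _).isInfix
  have hrev : CommEquiv M w w.reverse := by
    refine hfc _ _ hw rfl hw.reverse ?_
    rw [cs.wordProd_reverse, inv_eq_iff_mul_eq_one, hinv]
  have hvrev : CommEquiv M v v.reverse := by
    refine CommEquiv.of_pairFilter_eq_of_ne hM fun s t hst hMst => ?_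
    have h₁ := hrev.pairFilter_eq hMst
    have h₂ := hlong' s t hst hMst
    rw [pairFilter, pairFilter, List.filter_reverse] at h₁
    have h₃ := (hwin' s t hst hMst).reverse_take (forall_mem_pairFilter s t w) (by omega) h₁.symm
    rw [← hv s t hst hMst, pairFilter, ← List.filter_reverse] at h₃
    exact h₃.symm
  refine ⟨w, v, rfl, hw, hvred, ⟨⟨⟨hvfc, ?_⟩, ?_⟩, fun w' hw' hprod => ?_⟩, hv⟩
  · rw [← inv_eq_iff_mul_eq_one, ← cs.wordProd_reverse, ← hvrev.wordProd_eq cs]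
  · have := hvr.perm.length_eq
    rw [hw.eq, this, List.length_append, hr] at hlen
    rw [hvred.eq]
    omega
  · exact (hvfc v w' hvred rfl hw' hprod).isWindowed hvwin

theorem ncard_windowedFCInvolutions_le [DecidableEq B] [Fintype B]
    (hM : ∀ s, ∃ t, s ≠ t ∧ M s t ≠ 2) {c : B → ℕ} {L : ℕ}
    (hlong : ∀ w, cs.IsReduced w → cs.wordProd w ∈ fcInvolutions cs (L + ∑ s, c s) →
      ∀ s t, s ≠ t → M s t ≠ 2 → 2 * (c s + c t) ≤ (pairFilter s t w).length) :
    (windowedFCInvolutions cs c (L + ∑ s, c s)).ncard ≤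
      (windowedFCInvolutions cs c L).ncard := by
  have hex := fun g : windowedFCInvolutions cs c (L + ∑ s, c s) =>
    exists_shrink hM g.2 fun w hw hwg => hlong w hw (hwg ▸ g.2.1)
  choose w v hwg hw hvred hv hpair using hex
  have : Finite (windowedFCInvolutions cs c L) :=
    (finite_fcInvolutions cs L).subset fun g hg => hg.1
  refine Nat.card_le_card_of_injective (fun g => ⟨cs.wordProd (v g), hv g⟩) fun g g' heq => ?_
  have hvv := (hv g).1.1.1 _ _ (hvred g) rfl (hvred g') (congrArg Subtype.val heq).symm
  have hww : CommEquiv M (w g) (w g') := by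
    refine CommEquiv.of_pairFilter_eq_of_ne hM fun s t hst hMst => ?_
    have h := hvv.pairFilter_eq hMst
    rw [hpair g s t hst hMst, hpair g' s t hst hMst] at h
    exact HasUniformWindows.ext (forall_mem_pairFilter s t _) (forall_mem_pairFilter s t _)
      (g.2.2 _ (hw g) (hwg g) s t hst hMst) (g'.2.2 _ (hw g') (hwg g') s t hst hMst)
      (hlong _ (hw g) ((hwg g).symm ▸ g.2.1) s t hst hMst)
      (hlong _ (hw g') ((hwg g').symm ▸ g'.2.1) s t hst hMst) h
  exact Subtype.ext (by rw [← hwg g, ← hwg g', hww.wordProd_eq cs])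

theorem exists_forall_add_eq_of_add_le {a : ℕ → ℕ} {p N : ℕ}
    (h : ∀ L, N ≤ L → a (L + p) ≤ a L) : ∃ N', ∀ L, N' ≤ L → a (L + p) = a L := by
  set b : ℕ → ℕ := fun L => ∑ i ∈ Finset.range p, a (L + i) with hb
  have hstep : ∀ L, b (L + 1) + a L = b L + a (L + p) := by
    intro L
    have h₁ := Finset.sum_range_succ (fun i => a (L + i)) p
    have h₂ := Finset.sum_range_succ' (fun i => a (L + i)) p
    simp only [hb]
    simp only [add_zero] at h₂
    rw [← h₁, h₂]
    exact congrArg₂ _ (Finset.sum_congr rfl fun i _ => by rw [add_assoc, add_comm 1]) rfl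
  have hanti : ∀ L, N ≤ L → ∀ k, b (L + k) ≤ b L := by
    intro L hL k
    induction k with
    | zero => rfl
    | succ k ih =>
      have := hstep (L + k)
      have := h (L + k) (by omega)
      rw [← add_assoc]
      omega
  obtain ⟨m, ⟨L₀, hL₀, rfl⟩, hmin⟩ :=
    WellFounded.has_min (wellFounded_lt (α := ℕ)) (b '' Set.Ici N) ⟨_, N, Set.self_mem_Ici, rfl⟩
  refine ⟨L₀, fun L hL => ?_⟩
  have hN : N ≤ L₀ := hL₀
  have h₁ := hmin (b L) ⟨L, hN.trans hL, rfl⟩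
  have h₂ := hmin (b (L + 1)) ⟨L + 1, by simp only [Set.mem_Ici]; omega, rfl⟩
  have h₃ := hanti L₀ hN (L - L₀)
  have h₄ := hanti L₀ hN (L + 1 - L₀)
  have h₅ := hstep L
  rw [show L₀ + (L - L₀) = L by omega] at h₃
  rw [show L₀ + (L + 1 - L₀) = L + 1 by omega] at h₄
  omega

theorem exists_forall_add_mul_eq_of_add_le {a : ℕ → ℕ} {p N : ℕ} (k : ℕ)
    (h : ∀ L, N ≤ L → a (L + p) ≤ a L) : ∃ N', ∀ L, N' ≤ L → a (L + k * p) = a L := by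
  obtain ⟨N', hN'⟩ := exists_forall_add_eq_of_add_le h
  refine ⟨N', fun L hL => ?_⟩
  induction k with
  | zero => simp
  | succ k ih => rw [Nat.succ_mul, ← add_assoc, hN' _ (by omega), ih]

end Shrinking

section Heap

/-- The letter `v` is a neighbour of the path letter `i` on the fork side. -/
def IsRightNeighbor (n i v : ℕ) : Prop := v = i + 1 ∨ (i + 1 = n ∧ v = n + 1)

/-- Local conditions satisfied by the sequence of letters of a reduced word of a fully commutative
element of type `B̃_{n+1}`; the condition is invariant under reversal of the sequence. -/
structure IsAlternatingHeap (n : ℕ) (f : ℤ → ℕ) : Prop where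
  path : ∀ {i : ℕ} {x y : ℤ}, 1 ≤ i → i + 1 ≤ n → x < y → f x = i → f y = i →
    (∀ k, x < k → k < y → f k ≠ i) → (i = 1 ∧ ∃ z, x < z ∧ z < y ∧ f z = 0) ∨
      ∃ z z', x < z ∧ z < z' ∧ z' < y ∧ (f z + 1 = i ∨ IsRightNeighbor n i (f z)) ∧
        (f z' + 1 = i ∨ IsRightNeighbor n i (f z'))
  fork : ∀ {v : ℕ} {x y : ℤ}, v = n ∨ v = n + 1 → x < y → f x = v → f y = v →
    ∃ z z', x < z ∧ z < z' ∧ z' < y ∧ f z + 1 = n ∧ f z' + 1 = n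
  zero : ∀ {x y : ℤ}, x < y → f x = 0 → f y = 0 → ∃ z, x < z ∧ z < y ∧ f z = 1
  not_zero_one : ∀ {x y z t : ℤ}, x < y → y < z → z < t → f x = 0 → f y = 1 → f z = 0 → f t = 1 →
    (∀ k, x < k → k < z → k ≠ y → f k ≠ 0 ∧ f k ≠ 1) →
    (∀ k, y < k → k < t → k ≠ z → f k ≠ 0 ∧ f k ≠ 1 ∧ ¬ IsRightNeighbor n 1 (f k)) → False
  not_one_zero : ∀ {x y z t : ℤ}, x < y → y < z → z < t → f x = 1 → f y = 0 → f z = 1 → f t = 0 →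
    (∀ k, x < k → k < z → k ≠ y → f k ≠ 0 ∧ f k ≠ 1 ∧ ¬ IsRightNeighbor n 1 (f k)) →
    (∀ k, y < k → k < t → k ≠ z → f k ≠ 0 ∧ f k ≠ 1) → False

theorem Int.exists_last_between {P : ℤ → Prop} {x y : ℤ} (h : ∃ z, x < z ∧ z < y ∧ P z) :
    ∃ z, x < z ∧ z < y ∧ P z ∧ ∀ k, z < k → k < y → ¬ P k := by
  obtain ⟨z, ⟨h₁, h₂, h₃⟩, h₄⟩ := Int.exists_greatest_of_bdd (P := fun z => x < z ∧ z < y ∧ P z)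
    ⟨y, fun z hz => hz.2.1.le⟩ h
  refine ⟨z, h₁, h₂, h₃, fun k hk hky hP => ?_⟩
  have := h₄ k ⟨h₁.trans hk, hky, hP⟩
  omega

theorem Int.exists_first_between {P : ℤ → Prop} {x y : ℤ} (h : ∃ z, x < z ∧ z < y ∧ P z) :
    ∃ z, x < z ∧ z < y ∧ P z ∧ ∀ k, x < k → k < z → ¬ P k := by
  obtain ⟨z, ⟨h₁, h₂, h₃⟩, h₄⟩ := Int.exists_least_of_bdd (P := fun z => x < z ∧ z < y ∧ P z)
    ⟨x, fun z hz => hz.1.le⟩ h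
  refine ⟨z, h₁, h₂, h₃, fun k hk hkz hP => ?_⟩
  have := h₄ k ⟨hk, hkz.trans h₂, hP⟩
  omega

/-- The letter `i` occurs at the positions `x < y` and nowhere in between. -/
def IsGap (f : ℤ → ℕ) (i : ℕ) (x y : ℤ) : Prop :=
  x < y ∧ f x = i ∧ f y = i ∧ ∀ k, x < k → k < y → f k ≠ i

theorem IsGap.neg {f : ℤ → ℕ} {i : ℕ} {x y : ℤ} (h : IsGap f i x y) :
    IsGap (fun k => f (-k)) i (-y) (-x) :=
  ⟨by linarith [h.1], by simpa using h.2.2.1, by simpa using h.2.1,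
    fun k hk hk' => h.2.2.2 (-k) (by linarith) (by linarith)⟩

theorem isGap_neg {f : ℤ → ℕ} {i : ℕ} {x y : ℤ} :
    IsGap (fun k => f (-k)) i x y ↔ IsGap f i (-y) (-x) :=
  ⟨fun h => by simpa using h.neg, fun h => by simpa using h.neg⟩

theorem exists_isGap_right {f : ℤ → ℕ} {i : ℕ} {x y : ℤ} (hxy : x < y) (hx : f x = i)
    (hy : f y = i) : ∃ z, z ≤ y ∧ IsGap f i x z := by
  obtain ⟨z, h₁, h₂, h₃, h₄⟩ := Int.exists_first_between (P := fun k => f k = i) (x := x)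
    (y := y + 1) ⟨y, hxy, by omega, hy⟩
  exact ⟨z, by omega, h₁, hx, h₃, h₄⟩

theorem exists_isGap_left {f : ℤ → ℕ} {i : ℕ} {x y : ℤ} (hxy : x < y) (hx : f x = i)
    (hy : f y = i) : ∃ z, x ≤ z ∧ IsGap f i z y := by
  obtain ⟨z, h₁, h₂, h₃, h₄⟩ := Int.exists_last_between (P := fun k => f k = i) (x := x - 1)
    (y := y) ⟨x, by omega, hxy, hx⟩
  exact ⟨z, by omega, h₂, h₃, hy, h₄⟩

/-- A gap of the path letter `i` without neighbours of `i` on the fork side. -/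
def IsLeftGap (n : ℕ) (f : ℤ → ℕ) (i : ℕ) (x y : ℤ) : Prop :=
  IsGap f i x y ∧ ∀ k, x < k → k < y → ¬ IsRightNeighbor n i (f k)

/-- A gap of the path letter `i` without the letter `i - 1`. -/
def IsRightGap (f : ℤ → ℕ) (i : ℕ) (x y : ℤ) : Prop :=
  IsGap f i x y ∧ ∀ k, x < k → k < y → f k + 1 ≠ i

theorem isLeftGap_neg {n : ℕ} {f : ℤ → ℕ} {i : ℕ} {x y : ℤ} :
    IsLeftGap n (fun k => f (-k)) i x y ↔ IsLeftGap n f i (-y) (-x) := by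
  rw [IsLeftGap, IsLeftGap, isGap_neg]
  refine and_congr_right fun _ => ⟨fun h k hk hk' => ?_, fun h k hk hk' => ?_⟩
  · simpa using h (-k) (by linarith) (by linarith)
  · exact h (-k) (by linarith) (by linarith)

theorem isRightGap_neg {f : ℤ → ℕ} {i : ℕ} {x y : ℤ} :
    IsRightGap (fun k => f (-k)) i x y ↔ IsRightGap f i (-y) (-x) := by
  rw [IsRightGap, IsRightGap, isGap_neg]
  refine and_congr_right fun _ => ⟨fun h k hk hk' => ?_, fun h k hk hk' => ?_⟩
  · simpa using h (-k) (by linarith) (by linarith)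
  · exact h (-k) (by linarith) (by linarith)

namespace IsAlternatingHeap

variable {n i : ℕ} {f : ℤ → ℕ} {x y z : ℤ}

theorem neg (hf : IsAlternatingHeap n f) : IsAlternatingHeap n fun k => f (-k) where
  path hi hin hxy hx hy h := by
    rcases hf.path hi hin (neg_lt_neg hxy) hy hx fun k hk hk' => by
      simpa using h (-k) (by linarith) (by linarith) with ⟨h₁, z, h₂, h₃, h₄⟩ |
      ⟨z, z', h₁, h₂, h₃, h₄, h₅⟩
    · exact .inl ⟨h₁, -z, by linarith, by linarith, by simpa using h₄⟩
    · exact .inr ⟨-z', -z, by linarith, by linarith, by linarith, by simpa using h₅,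
        by simpa using h₄⟩
  fork hv hxy hx hy := by
    obtain ⟨z, z', h₁, h₂, h₃, h₄, h₅⟩ := hf.fork hv (neg_lt_neg hxy) hy hx
    exact ⟨-z', -z, by linarith, by linarith, by linarith, by simpa using h₅, by simpa using h₄⟩
  zero hxy hx hy := by
    obtain ⟨z, h₁, h₂, h₃⟩ := hf.zero (neg_lt_neg hxy) hy hx
    exact ⟨-z, by linarith, by linarith, by simpa using h₃⟩
  not_zero_one {x y z t} hxy hyz hzt hx hy hz ht h h' :=
    hf.not_one_zero (neg_lt_neg hzt) (neg_lt_neg hyz) (neg_lt_neg hxy) ht hz hy hx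
      (fun k hk hk' hne => by
        simpa using h' (-k) (by linarith) (by linarith) fun e => hne (by linarith))
      (fun k hk hk' hne => by
        simpa using h (-k) (by linarith) (by linarith) fun e => hne (by linarith))
  not_one_zero {x y z t} hxy hyz hzt hx hy hz ht h h' :=
    hf.not_zero_one (neg_lt_neg hzt) (neg_lt_neg hyz) (neg_lt_neg hxy) ht hz hy hx
      (fun k hk hk' hne => by
        simpa using h' (-k) (by linarith) (by linarith) fun e => hne (by linarith))
      (fun k hk hk' hne => by
        simpa using h (-k) (by linarith) (by linarith) fun e => hne (by linarith))

theorem exists_isGap_of_isLeftGap (hf : IsAlternatingHeap n f) (hi : 1 ≤ i) (hin : i + 2 ≤ n)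
    (h : IsLeftGap n f (i + 1) x y) :
    ∃ b c, x < b ∧ c < y ∧ IsLeftGap n f i b c ∧ ∀ k, c < k → k < y → f k ≠ i := by
  obtain ⟨⟨hxy, hx, hy, hgap⟩, hR⟩ := h
  rcases hf.path (by omega) (by omega) hxy hx hy hgap with ⟨h₁, -⟩ | ⟨z, z', h₁, h₂, h₃, h₄, h₅⟩
  · omega
  have hz : f z = i := by
    have := h₄.resolve_right (hR z h₁ (h₂.trans h₃))
    omega
  have hz' : f z' = i := by
    have := h₅.resolve_right (hR z' (h₁.trans h₂) h₃)
    omega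
  obtain ⟨c, hc₁, hc₂, hc₃, hc₄⟩ := Int.exists_last_between (P := fun k => f k = i)
    ⟨z', h₂, h₃, hz'⟩
  obtain ⟨b, hb₁, hb₂⟩ := exists_isGap_left hc₁ hz hc₃
  refine ⟨b, c, by omega, hc₂, ⟨hb₂, fun k hk hk' hkR => ?_⟩, hc₄⟩
  rcases hkR with h | h
  · exact hgap k (by omega) (by omega) h
  · omega

theorem exists_isGap_of_isRightGap (hf : IsAlternatingHeap n f) (hi : 1 ≤ i) (hin : i + 2 ≤ n)
    (h : IsRightGap f i x y) :
    ∃ b c, x < b ∧ c < y ∧ IsRightGap f (i + 1) b c ∧ ∀ k, c < k → k < y → f k ≠ i + 1 := by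
  obtain ⟨⟨hxy, hx, hy, hgap⟩, hL⟩ := h
  rcases hf.path (by omega) (by omega) hxy hx hy hgap with
    ⟨rfl, z, h₁, h₂, h₃⟩ | ⟨z, z', h₁, h₂, h₃, h₄, h₅⟩
  · exact absurd (by omega) (hL z h₁ h₂)
  have hz : f z = i + 1 := by
    rcases h₄.resolve_left (hL z h₁ (h₂.trans h₃)) with h | h <;> omega
  have hz' : f z' = i + 1 := by
    rcases h₅.resolve_left (hL z' (h₁.trans h₂) h₃) with h | h <;> omega
  obtain ⟨c, hc₁, hc₂, hc₃, hc₄⟩ := Int.exists_last_between (P := fun k => f k = i + 1)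
    ⟨z', h₂, h₃, hz'⟩
  obtain ⟨b, hb₁, hb₂⟩ := exists_isGap_left hc₁ hz hc₃
  exact ⟨b, c, by omega, hc₂, ⟨hb₂, fun k hk hk' hkL =>
    hgap k (by omega) (by omega) (by omega)⟩, hc₄⟩

theorem exists_of_isLeftGap_one (hf : IsAlternatingHeap n f) (hn : 2 ≤ n)
    (h : IsLeftGap n f 1 x y) :
    ∃ z, x < z ∧ z < y ∧ f z = 0 ∧ ∀ k, x < k → k < y → k ≠ z → f k ≠ 0 := by
  obtain ⟨⟨hxy, hx, hy, hgap⟩, hR⟩ := h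
  have : ∃ z, x < z ∧ z < y ∧ f z = 0 := by
    rcases hf.path le_rfl (by omega) hxy hx hy hgap with ⟨-, h⟩ | ⟨z, z', h₁, h₂, h₃, h₄, -⟩
    · exact h
    · have := h₄.resolve_right (hR z h₁ (h₂.trans h₃))
      exact ⟨z, h₁, h₂.trans h₃, by omega⟩
  obtain ⟨z, h₁, h₂, h₃⟩ := this
  refine ⟨z, h₁, h₂, h₃, fun k hk hk' hne h => ?_⟩
  rcases lt_or_gt_of_ne hne with hlt | hlt
  · obtain ⟨l, hl, hl', h₁⟩ := hf.zero hlt h h₃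
    exact hgap l (by omega) (by omega) h₁
  · obtain ⟨l, hl, hl', h₁⟩ := hf.zero hlt h₃ h
    exact hgap l (by omega) (by omega) h₁

theorem exists_eq_of_isLeftGap (hf : IsAlternatingHeap n f) (hi : 1 ≤ i) (hin : i + 1 ≤ n)
    (h : IsLeftGap n f i x y) (hyz : y < z) (hz : f z + 1 = i) : ∃ k, y < k ∧ k < z ∧ f k = i := by
  by_contra! hno
  induction i, hi using Nat.le_induction generalizing x y z with
  | base =>
    obtain ⟨a, ha₁, ha₂, ha₃, ha₄⟩ := hf.exists_of_isLeftGap_one hin h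
    obtain ⟨⟨hxy, hx, hy, hgap⟩, hR⟩ := h
    obtain ⟨d, hd₁, hd₂, hd₃, hd₄⟩ := Int.exists_first_between (P := fun k => f k = 0)
      (x := y) (y := z + 1) ⟨z, hyz, by omega, by omega⟩
    refine hf.not_one_zero ha₁ ha₂ hd₁ hx ha₃ hy hd₃
      (fun k hk hk' hne => ⟨ha₄ k hk hk' hne, hgap k hk hk', hR k hk hk'⟩) fun k hk hk' hne => ?_
    rcases lt_or_gt_of_ne hne with hlt | hlt
    · exact ⟨ha₄ k (by omega) hlt (by omega), hgap k (by omega) hlt⟩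
    · exact ⟨hd₄ k hlt hk', hno k hlt (by omega)⟩
  | succ i hi ih =>
    obtain ⟨b, c, hb, hc, hbc, hcy⟩ := hf.exists_isGap_of_isLeftGap hi hin h
    obtain ⟨⟨hxy, hx, hy, hgap⟩, hR⟩ := h
    obtain ⟨d, hd₁, hd₂, hd₃, hd₄⟩ := Int.exists_first_between (P := fun k => f k = i)
      (x := y) (y := z + 1) ⟨z, hyz, by omega, by omega⟩
    have hcgap : ∀ k, c < k → k < d → f k ≠ i := by
      intro k hk hk'
      rcases lt_trichotomy k y with hlt | rfl | hlt
      · exact hcy k hk hlt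
      · omega
      · exact hd₄ k hlt hk'
    have hone : ∀ k, c < k → k < d → IsRightNeighbor n i (f k) → k = y := by
      intro k hk hk' hkR
      have hki : f k = i + 1 := by rcases hkR with h | h <;> omega
      by_contra hne
      rcases lt_or_gt_of_ne hne with hlt | hlt
      · exact hgap k (by have := hbc.1.1; omega) hlt hki
      · exact hno k hlt (by omega) hki
    have : ∃ e, c < e ∧ e < d ∧ f e + 1 = i := by
      rcases hf.path hi (by omega) (hc.trans hd₁) hbc.1.2.2.1 hd₃ hcgap with
        ⟨rfl, e, h₁, h₂, h₃⟩ | ⟨e, e', h₁, h₂, h₃, h₄, h₅⟩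
      · exact ⟨e, h₁, h₂, by omega⟩
      · rcases h₄ with h₄ | h₄
        · exact ⟨e, h₁, h₂.trans h₃, h₄⟩
        rcases h₅ with h₅ | h₅
        · exact ⟨e', h₁.trans h₂, h₃, h₅⟩
        have := hone e h₁ (h₂.trans h₃) h₄
        have := hone e' (h₁.trans h₂) h₃ h₅
        omega
    obtain ⟨e, he₁, he₂, he₃⟩ := this
    exact ih (by omega) hbc he₁ he₃ fun k hk hk' => hcgap k hk (hk'.trans he₂)

theorem exists_fork_of_isRightGap (hf : IsAlternatingHeap n f) (hn : 2 ≤ n)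
    (h : IsRightGap f (n - 1) x y) {v : ℕ} (hv : v = n ∨ v = n + 1) :
    ∃ z, x < z ∧ z < y ∧ f z = v := by
  obtain ⟨⟨hxy, hx, hy, hgap⟩, hL⟩ := h
  rcases hf.path (by omega) (by omega) hxy hx hy hgap with
    ⟨h₀, z, h₁, h₂, h₃⟩ | ⟨z, z', h₁, h₂, h₃, h₄, h₅⟩
  · exact absurd (by omega) (hL z h₁ h₂)
  have h₄' := h₄.resolve_left (hL z h₁ (h₂.trans h₃))
  have h₅' := h₅.resolve_left (hL z' (h₁.trans h₂) h₃)
  have hz : f z = n ∨ f z = n + 1 := by rcases h₄' with h | h <;> omega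
  have hz' : f z' = n ∨ f z' = n + 1 := by rcases h₅' with h | h <;> omega
  have hne : f z ≠ f z' := by
    intro he
    obtain ⟨k, k', hk₁, hk₂, hk₃, hk₄, -⟩ := hf.fork hz h₂ rfl he.symm
    exact hgap k (by omega) (by omega) (by omega)
  by_cases hzv : f z = v
  · exact ⟨z, h₁, by omega, hzv⟩
  · exact ⟨z', by omega, h₃, by omega⟩

theorem exists_eq_of_isRightGap (hf : IsAlternatingHeap n f) (hi : 1 ≤ i) (hin : i + 1 ≤ n)
    (h : IsRightGap f i x y) (hyz : y < z) (hz : IsRightNeighbor n i (f z)) :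
    ∃ k, y < k ∧ k < z ∧ f k = i := by
  by_contra! hno
  obtain ⟨m, hm⟩ : ∃ m, m + i + 1 = n := ⟨n - (i + 1), by omega⟩
  induction m generalizing i x y z with
  | zero =>
    have hi' : n - 1 = i := by omega
    have hv : f z = n ∨ f z = n + 1 := by rcases hz with h | h <;> omega
    obtain ⟨a, ha₁, ha₂, ha₃⟩ := hf.exists_fork_of_isRightGap (by omega) (hi' ▸ h) hv
    obtain ⟨k, k', h₁, h₂, h₃, h₄, h₅⟩ := hf.fork hv (ha₂.trans hyz) ha₃ rfl
    obtain ⟨⟨hxy, hx, hy, hgap⟩, hL⟩ := h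
    have hone : ∀ k, a < k → k < z → f k + 1 = n → k = y := by
      intro k hk hk' hki
      by_contra hne
      rcases lt_or_gt_of_ne hne with hlt | hlt
      · exact hgap k (by omega) hlt (by omega)
      · exact hno k hlt (by omega) (by omega)
    have := hone k h₁ (by omega) h₄
    have := hone k' (by omega) h₃ h₅
    omega
  | succ m ih =>
    obtain ⟨b, c, hb, hc, hbc, hcy⟩ := hf.exists_isGap_of_isRightGap hi (by omega) h
    obtain ⟨⟨hxy, hx, hy, hgap⟩, hL⟩ := h
    obtain ⟨d, hd₁, hd₂, hd₃, hd₄⟩ := Int.exists_first_between (P := fun k => f k = i + 1)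
      (x := y) (y := z + 1) ⟨z, hyz, by omega, by rcases hz with h | h <;> omega⟩
    have hcgap : ∀ k, c < k → k < d → f k ≠ i + 1 := by
      intro k hk hk'
      rcases lt_trichotomy k y with hlt | rfl | hlt
      · exact hcy k hk hlt
      · omega
      · exact hd₄ k hlt hk'
    have hone : ∀ k, c < k → k < d → f k + 1 = i + 1 → k = y := by
      intro k hk hk' hki
      by_contra hne
      rcases lt_or_gt_of_ne hne with hlt | hlt
      · exact hgap k (by have := hbc.1.1; omega) hlt (by omega)
      · exact hno k hlt (by omega) (by omega)
    have : ∃ e, c < e ∧ e < d ∧ IsRightNeighbor n (i + 1) (f e) := by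
      rcases hf.path (by omega) (by omega) (hc.trans hd₁) hbc.1.2.2.1 hd₃ hcgap with
        ⟨h₀, -⟩ | ⟨e, e', h₁, h₂, h₃, h₄, h₅⟩
      · omega
      · rcases h₄ with h₄ | h₄
        · rcases h₅ with h₅ | h₅
          · have := hone e h₁ (h₂.trans h₃) h₄
            have := hone e' (h₁.trans h₂) h₃ h₅
            omega
          · exact ⟨e', h₁.trans h₂, h₃, h₅⟩
        · exact ⟨e, h₁, h₂.trans h₃, h₄⟩
    obtain ⟨e, he₁, he₂, he₃⟩ := this
    exact ih (by omega) (by omega) hbc he₁ he₃ (fun k hk hk' => hcgap k hk (hk'.trans he₂))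
      (by omega)

theorem isRightGap_of_isLeftGap (hf : IsAlternatingHeap n f) (hi : 1 ≤ i) (hin : i + 1 ≤ n)
    (h : IsLeftGap n f i x y) (hyz : IsGap f i y z) : IsRightGap f i y z := by
  refine ⟨hyz, fun k hk hk' hki => ?_⟩
  obtain ⟨l, hl, hl', hli⟩ := hf.exists_eq_of_isLeftGap hi hin h hk hki
  exact hyz.2.2.2 l hl (hl'.trans hk') hli

theorem isLeftGap_of_isRightGap (hf : IsAlternatingHeap n f) (hi : 1 ≤ i) (hin : i + 1 ≤ n)
    (h : IsRightGap f i x y) (hyz : IsGap f i y z) : IsLeftGap n f i y z := by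
  refine ⟨hyz, fun k hk hk' hki => ?_⟩
  obtain ⟨l, hl, hl', hli⟩ := hf.exists_eq_of_isRightGap hi hin h hk hki
  exact hyz.2.2.2 l hl (hl'.trans hk') hli

theorem not_isRightGap_of_isLeftGap (hf : IsAlternatingHeap n f) (hi : 1 ≤ i) (hin : i + 1 ≤ n)
    (h : IsLeftGap n f i x y) : ¬ IsRightGap f i x y := by
  intro h'
  obtain ⟨⟨hxy, hx, hy, hgap⟩, hR⟩ := h
  rcases hf.path hi hin hxy hx hy hgap with ⟨rfl, z, h₁, h₂, h₃⟩ | ⟨z, z', h₁, h₂, h₃, h₄, -⟩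
  · exact h'.2 z h₁ h₂ (by omega)
  · exact h₄.elim (h'.2 z h₁ (h₂.trans h₃)) (hR z h₁ (h₂.trans h₃))

theorem exists_left_of_not_isRightGap (h : IsGap f i x y) (h' : ¬ IsRightGap f i x y) :
    ∃ z, x < z ∧ z < y ∧ f z + 1 = i := by
  by_contra! hno
  exact h' ⟨h, hno⟩

theorem exists_right_of_not_isLeftGap (h : IsGap f i x y) (h' : ¬ IsLeftGap n f i x y) :
    ∃ z, x < z ∧ z < y ∧ IsRightNeighbor n i (f z) := by
  by_contra! hno
  exact h' ⟨h, hno⟩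

theorem turned_of_turned_of_le (hf : IsAlternatingHeap n f) (hi : 1 ≤ i) (hin : i + 1 ≤ n)
    (h : IsLeftGap n f i x y ∨ IsRightGap f i x y) {x' y' : ℤ} (h' : IsGap f i x' y')
    (hxx' : x ≤ x') : IsLeftGap n f i x' y' ∨ IsRightGap f i x' y' := by
  obtain ⟨m, hm⟩ : ∃ m : ℕ, x' - x ≤ m := ⟨(x' - x).toNat, by omega⟩
  have hxy : IsGap f i x y := h.elim And.left And.left
  induction m generalizing x' y' with
  | zero =>
    obtain rfl : x = x' := by omega
    obtain rfl : y = y' := by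
      rcases lt_trichotomy y y' with hlt | rfl | hlt
      · exact absurd hxy.2.2.1 (h'.2.2.2 y hxy.1 hlt)
      · rfl
      · exact absurd h'.2.2.1 (hxy.2.2.2 y' h'.1 hlt)
    exact h
  | succ m ih =>
    rcases hxx'.eq_or_lt with rfl | hlt
    · exact ih h' le_rfl (by omega)
    · obtain ⟨w, hw, hwx⟩ := exists_isGap_left hlt hxy.2.1 h'.2.1
      rcases ih hwx hw (by have := hwx.1; omega) with hl | hr
      · exact .inr (hf.isRightGap_of_isLeftGap hi hin hl h')
      · exact .inl (hf.isLeftGap_of_isRightGap hi hin hr h')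

theorem turned_of_turned (hf : IsAlternatingHeap n f) (hi : 1 ≤ i) (hin : i + 1 ≤ n)
    (h : IsLeftGap n f i x y ∨ IsRightGap f i x y) {x' y' : ℤ} (h' : IsGap f i x' y') :
    IsLeftGap n f i x' y' ∨ IsRightGap f i x' y' := by
  rcases le_or_gt x x' with hle | hlt
  · exact hf.turned_of_turned_of_le hi hin h h' hle
  · have hxy : IsGap f i x y := h.elim And.left And.left
    have hle : -y ≤ -y' := by
      by_contra! hy
      exact h'.2.2.2 x hlt (by have := hxy.1; omega) hxy.2.1
    have := hf.neg.turned_of_turned_of_le hi hin (x := -y) (y := -x) (x' := -y') (y' := -x')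
      (by simpa [isLeftGap_neg, isRightGap_neg] using h) h'.neg hle
    simpa [isLeftGap_neg, isRightGap_neg] using this

theorem dichotomy (hf : IsAlternatingHeap n f)
    (h : ∀ i, 1 ≤ i → i + 1 ≤ n → ∃ x y z, IsGap f i x y ∧ IsGap f i y z) :
    (∀ i x y, 1 ≤ i → i + 1 ≤ n → IsGap f i x y →
      ¬ IsLeftGap n f i x y ∧ ¬ IsRightGap f i x y) ∨
    ∀ i x y, 1 ≤ i → i + 1 ≤ n → IsGap f i x y → IsLeftGap n f i x y ∨ IsRightGap f i x y := by
  by_cases hturned : ∃ i x y, 1 ≤ i ∧ i + 1 ≤ n ∧ (IsLeftGap n f i x y ∨ IsRightGap f i x y)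
  · right
    obtain ⟨i₀, x₀, y₀, hi₀, hin₀, h₀⟩ := hturned
    have hboth : ∀ i, 1 ≤ i → i + 1 ≤ n →
        (∃ x y, IsLeftGap n f i x y ∨ IsRightGap f i x y) →
        (∃ x y, IsLeftGap n f i x y) ∧ ∃ x y, IsRightGap f i x y := by
      rintro i hi hin ⟨x', y', h'⟩
      obtain ⟨x, y, z, hxy, hyz⟩ := h i hi hin
      rcases hf.turned_of_turned hi hin h' hxy with hl | hr
      · exact ⟨⟨x, y, hl⟩, y, z, hf.isRightGap_of_isLeftGap hi hin hl hyz⟩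
      · exact ⟨⟨y, z, hf.isLeftGap_of_isRightGap hi hin hr hyz⟩, x, y, hr⟩
    have hup : ∀ i, i₀ ≤ i → i + 1 ≤ n → ∃ x y, IsLeftGap n f i x y ∨ IsRightGap f i x y := by
      intro i hi
      induction i, hi using Nat.le_induction with
      | base => exact fun _ => ⟨x₀, y₀, h₀⟩
      | succ i hi ih =>
        intro hin
        obtain ⟨-, x, y, hr⟩ := hboth i (by omega) (by omega) (ih (by omega))
        obtain ⟨b, c, -, -, hbc, -⟩ := hf.exists_isGap_of_isRightGap (by omega) (by omega) hr
        exact ⟨b, c, .inr hbc⟩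
    have hdown : ∀ m i, i + m = i₀ → 1 ≤ i →
        ∃ x y, IsLeftGap n f i x y ∨ IsRightGap f i x y := by
      intro m
      induction m with
      | zero =>
        rintro i rfl -
        exact ⟨x₀, y₀, h₀⟩
      | succ m ih =>
        intro i him hi
        obtain ⟨⟨x, y, hl⟩, -⟩ := hboth (i + 1) (by omega) (by omega)
          (ih (i + 1) (by omega) (by omega))
        obtain ⟨b, c, -, -, hbc, -⟩ := hf.exists_isGap_of_isLeftGap (by omega) (by omega) hl
        exact ⟨b, c, .inl hbc⟩
    intro i x y hi hin hxy
    obtain ⟨x', y', h'⟩ : ∃ x y, IsLeftGap n f i x y ∨ IsRightGap f i x y := by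
      rcases le_or_gt i₀ i with hle | hlt
      · exact hup i hle hin
      · exact hdown (i₀ - i) i (by omega) hi
    exact hf.turned_of_turned hi hin h' hxy
  · left
    intro i x y hi hin hxy
    exact ⟨fun hl => hturned ⟨i, x, y, hi, hin, .inl hl⟩,
      fun hr => hturned ⟨i, x, y, hi, hin, .inr hr⟩⟩

theorem not_two_gaps_of_right (hf : IsAlternatingHeap n f) (hi : 1 ≤ i) (hin : i + 1 ≤ n)
    (h : IsGap f i x y) (h' : IsGap f i y z)
    (hno : ∀ k, x < k → k < z → k ≠ y → ¬ IsRightNeighbor n i (f k)) : False := by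
  have hl : IsLeftGap n f i x y := ⟨h, fun k hk hk' => hno k hk (hk'.trans h'.1) hk'.ne⟩
  exact hf.not_isRightGap_of_isLeftGap hi hin
    ⟨h', fun k hk hk' => hno k (h.1.trans hk) hk' hk.ne'⟩
    (hf.isRightGap_of_isLeftGap hi hin hl h')

theorem not_two_gaps_of_left (hf : IsAlternatingHeap n f) (hi : 1 ≤ i) (hin : i + 1 ≤ n)
    (h : IsGap f i x y) (h' : IsGap f i y z)
    (hno : ∀ k, x < k → k < z → k ≠ y → f k + 1 ≠ i) : False := by
  have hr : IsRightGap f i x y := ⟨h, fun k hk hk' => hno k hk (hk'.trans h'.1) hk'.ne⟩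
  exact hf.not_isRightGap_of_isLeftGap hi hin (hf.isLeftGap_of_isRightGap hi hin hr h')
    ⟨h', fun k hk hk' => hno k (h.1.trans hk) hk' hk.ne'⟩

theorem not_two_gaps_of_fork (hf : IsAlternatingHeap n f) (hn : 2 ≤ n)
    (h : IsGap f (n - 1) x y) (h' : IsGap f (n - 1) y z) {v : ℕ} (hv : v = n ∨ v = n + 1)
    (hno : ∀ k, x < k → k < z → k ≠ y → f k ≠ v) : False := by
  have hn1 : 1 ≤ n - 1 := by omega
  have hn2 : n - 1 + 1 ≤ n := by omega
  have hr : ¬ IsRightGap f (n - 1) x y := fun hr => by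
    obtain ⟨k, hk, hk', hkv⟩ := hf.exists_fork_of_isRightGap hn hr hv
    exact hno k hk (hk'.trans h'.1) hk'.ne hkv
  have hr' : ¬ IsRightGap f (n - 1) y z := fun hr => by
    obtain ⟨k, hk, hk', hkv⟩ := hf.exists_fork_of_isRightGap hn hr hv
    exact hno k (h.1.trans hk) hk' hk.ne' hkv
  obtain ⟨a, ha, ha', haR⟩ := exists_right_of_not_isLeftGap h fun hl =>
    hr' (hf.isRightGap_of_isLeftGap hn1 hn2 hl h')
  by_cases hl' : IsLeftGap n f (n - 1) y z
  · refine hr ?_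
    have := hf.neg.isRightGap_of_isLeftGap hn1 hn2 (x := -z) (y := -y) (z := -x)
      (by simpa [isLeftGap_neg] using hl') h.neg
    simpa [isRightGap_neg] using this
  obtain ⟨b, hb, hb', hbR⟩ := exists_right_of_not_isLeftGap h' hl'
  have hfa : f a = n ∨ f a = n + 1 := by rcases haR with h | h <;> omega
  have hfb : f b = n ∨ f b = n + 1 := by rcases hbR with h | h <;> omega
  have hav := hno a ha (ha'.trans h'.1) ha'.ne
  have hbv := hno b (h.1.trans hb) hb' hb.ne'
  obtain ⟨k, k', h₁, h₂, h₃, h₄, h₅⟩ := hf.fork hfa (ha'.trans hb) rfl (by omega)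
  have hone : ∀ k, a < k → k < b → f k + 1 = n → k = y := by
    intro k hk hk' hki
    rcases lt_trichotomy k y with hlt | rfl | hlt
    · exact absurd (by omega) (h.2.2.2 k (by omega) hlt)
    · rfl
    · exact absurd (by omega) (h'.2.2.2 k hlt (by omega))
  have := hone k h₁ (by omega) h₄
  have := hone k' (by omega) h₃ h₅
  omega

theorem not_single_right (hf : IsAlternatingHeap n f) (hi : 1 ≤ i) (hin : i + 2 ≤ n)
    (h : IsLeftGap n f i x z ∨ IsRightGap f i x z) (hxy : x < y) (hyz : y < z)
    (hy : f y = i + 1) (hno : ∀ k, x < k → k < z → k ≠ y → f k ≠ i + 1) : False := by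
  have hr := h.resolve_left fun h => h.2 y hxy hyz (.inl hy)
  obtain ⟨b, c, hb, hc, ⟨⟨hbc, hfb, hfc, -⟩, -⟩, -⟩ :=
    hf.exists_isGap_of_isRightGap hi hin hr
  have h₁ : b = y := by
    by_contra hne
    exact hno b hb (hbc.trans hc) hne hfb
  have h₂ : c = y := by
    by_contra hne
    exact hno c (hb.trans hbc) hc hne hfc
  omega

theorem not_single_left (hf : IsAlternatingHeap n f) (hi : 1 ≤ i) (hin : i + 2 ≤ n)
    (h : IsLeftGap n f (i + 1) x z ∨ IsRightGap f (i + 1) x z) (hxy : x < y) (hyz : y < z)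
    (hy : f y = i) (hno : ∀ k, x < k → k < z → k ≠ y → f k ≠ i) : False := by
  have hl := h.resolve_right fun h => h.2 y hxy hyz (by omega)
  obtain ⟨b, c, hb, hc, ⟨⟨hbc, hfb, hfc, -⟩, -⟩, -⟩ :=
    hf.exists_isGap_of_isLeftGap hi hin hl
  have h₁ : b = y := by
    by_contra hne
    exact hno b hb (hbc.trans hc) hne hfb
  have h₂ : c = y := by
    by_contra hne
    exact hno c (hb.trans hbc) hc hne hfc
  omega

theorem not_single_fork (hf : IsAlternatingHeap n f) {v : ℕ} (hv : v = n ∨ v = n + 1)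
    (hxz : x < z) (hx : f x = v) (hz : f z = v)
    (hno : ∀ k, x < k → k < z → k ≠ y → f k + 1 ≠ n) : False := by
  obtain ⟨k, k', h₁, h₂, h₃, h₄, h₅⟩ := hf.fork hv hxz hx hz
  by_cases hk : k = y
  · exact hno k' (h₁.trans h₂) h₃ (by omega) h₅
  · exact hno k h₁ (h₂.trans h₃) hk h₄

theorem not_single_one (hf : IsAlternatingHeap n f) (hn : 2 ≤ n)
    (hturned : ∀ x y, IsGap f 1 x y → IsLeftGap n f 1 x y ∨ IsRightGap f 1 x y)
    (hex : ∃ k, f k = 1 ∧ k ≠ y)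
    (hxy : x < y) (hyz : y < z) (hx : f x = 0) (hy : f y = 1) (hz : f z = 0)
    (hno : ∀ k, x < k → k < z → k ≠ y → f k ≠ 1) : False := by
  have key : ∀ {g : ℤ → ℕ} {x y z k : ℤ}, IsAlternatingHeap n g →
      (∀ x y, IsGap g 1 x y → IsLeftGap n g 1 x y ∨ IsRightGap g 1 x y) → g k = 1 → k < y →
      x < y → y < z → g x = 0 → g y = 1 → g z = 0 →
      (∀ k, x < k → k < z → k ≠ y → g k ≠ 1) → False := by
    intro g x y z k hg hturned hk hky hxy hyz hx hy hz hno
    obtain ⟨w, -, hw⟩ := exists_isGap_left hky hk hy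
    have hwx : w < x := by
      by_contra! hle
      rcases hle.eq_or_lt with rfl | hlt
      · have := hw.2.1
        omega
      · exact hno w hlt (hw.1.trans hyz) hw.1.ne hw.2.1
    have hl := (hturned w y hw).resolve_right fun hr => hr.2 x hwx hxy (by omega)
    obtain ⟨l, hl, hl', h₁⟩ := hg.exists_eq_of_isLeftGap le_rfl (by omega) hl hyz (by omega)
    exact hno l (hxy.trans hl) hl' hl.ne' h₁
  obtain ⟨k, hk, hky⟩ := hex
  rcases lt_or_gt_of_ne hky with hlt | hlt
  · exact key hf hturned hk hlt hxy hyz hx hy hz hno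
  · refine key (x := -z) (y := -y) (z := -x) (k := -k) hf.neg (fun x y hg => ?_) (by simpa using hk)
      (by omega) (by omega) (by omega) (by simpa using hz) (by simpa using hy) (by simpa using hx)
      fun l hl hl' hne => hno (-l) (by omega) (by omega) (by omega)
    rw [isLeftGap_neg, isRightGap_neg]
    exact hturned _ _ (isGap_neg.1 hg)

end IsAlternatingHeap

end Heap

section Patterns

theorem List.exists_of_infix_filter {α : Type*} {p : α → Bool} {l : List α} {a b : α}
    (h : [a, b] <:+: l.filter p) :
    ∃ u v r, l = u ++ a :: (v ++ b :: r) ∧ ∀ x ∈ v, ¬ p x := by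
  obtain ⟨l₁, l₂, h⟩ := h
  rw [List.append_assoc] at h
  obtain ⟨u₁, u₂, rfl, -, h₂⟩ := List.filter_eq_append_iff.1 h.symm
  obtain ⟨u₃, u₄, rfl, -, -, h₃⟩ := List.filter_eq_cons_iff.1 h₂
  obtain ⟨u₅, u₆, rfl, hu, -, -⟩ := List.filter_eq_cons_iff.1 h₃
  exact ⟨u₁ ++ u₃, u₅, u₆, by simp, hu⟩

theorem List.exists_of_infix_filter_three {α : Type*} {p : α → Bool} {l : List α} {a b c : α}
    (h : [a, b, c] <:+: l.filter p) :
    ∃ u v v' r, l = u ++ a :: (v ++ b :: (v' ++ c :: r)) ∧ (∀ x ∈ v, ¬ p x) ∧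
      ∀ x ∈ v', ¬ p x := by
  obtain ⟨l₁, l₂, h⟩ := h
  rw [List.append_assoc] at h
  obtain ⟨u₁, u₂, rfl, -, h₂⟩ := List.filter_eq_append_iff.1 h.symm
  obtain ⟨u₃, u₄, rfl, -, -, h₃⟩ := List.filter_eq_cons_iff.1 h₂
  obtain ⟨u₅, u₆, rfl, hu, -, h₄⟩ := List.filter_eq_cons_iff.1 h₃
  obtain ⟨u₇, u₈, rfl, hu', -, -⟩ := List.filter_eq_cons_iff.1 h₄
  exact ⟨u₁ ++ u₃, u₅, u₇, u₈, by simp, hu, hu'⟩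

variable {B : Type*} [DecidableEq B] {l : List B} {s t : B}

theorem HasUniformWindows.two_of_avoid (hst : s ≠ t) (hl : ∀ b ∈ l, b = s ∨ b = t)
    (hs : ¬ [s, s] <:+: l) (ht : ¬ [t, t] <:+: l) : HasUniformWindows l s (2 + 2) 2 := by
  rintro f hf hlen
  obtain ⟨a, b, c, d, rfl⟩ := List.length_eq_four.1 hlen
  have h₁ : [a, b] <:+: l := List.IsInfix.trans ⟨[], [c, d], rfl⟩ hf
  have h₂ : [b, c] <:+: l := List.IsInfix.trans ⟨[a], [d], rfl⟩ hf
  have h₃ : [c, d] <:+: l := List.IsInfix.trans ⟨[a, b], [], rfl⟩ hf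
  rcases hl a (hf.subset (by simp)) with rfl | rfl <;>
  rcases hl b (hf.subset (by simp)) with rfl | rfl <;>
  rcases hl c (hf.subset (by simp)) with rfl | rfl <;>
  rcases hl d (hf.subset (by simp)) with rfl | rfl <;>
  first | contradiction | simp [hst, hst.symm]

theorem HasUniformWindows.two_of_avoid_three (hst : s ≠ t) (hl : ∀ b ∈ l, b = s ∨ b = t)
    (hs : ¬ [s, s, s] <:+: l) (ht : ¬ [t, t, t] <:+: l) (hsts : ¬ [s, t, s] <:+: l)
    (htst : ¬ [t, s, t] <:+: l) : HasUniformWindows l s (2 + 2) 2 := by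
  rintro f hf hlen
  obtain ⟨a, b, c, d, rfl⟩ := List.length_eq_four.1 hlen
  have h₁ : [a, b, c] <:+: l := List.IsInfix.trans ⟨[], [d], rfl⟩ hf
  have h₂ : [b, c, d] <:+: l := List.IsInfix.trans ⟨[a], [], rfl⟩ hf
  rcases hl a (hf.subset (by simp)) with rfl | rfl <;>
  rcases hl b (hf.subset (by simp)) with rfl | rfl <;>
  rcases hl c (hf.subset (by simp)) with rfl | rfl <;>
  rcases hl d (hf.subset (by simp)) with rfl | rfl <;>
  first | contradiction | simp [hst, hst.symm]

theorem HasUniformWindows.one_of_avoid (hst : s ≠ t) (hl : ∀ b ∈ l, b = s ∨ b = t)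
    (hs : ¬ [s, s] <:+: l) (hsts : ¬ [s, t, s] <:+: l) (ht : ¬ [t, t, t] <:+: l) :
    HasUniformWindows l s (1 + 2) 1 := by
  rintro f hf hlen
  obtain ⟨a, b, c, rfl⟩ := List.length_eq_three.1 hlen
  have h₁ : [a, b] <:+: l := List.IsInfix.trans ⟨[], [c], rfl⟩ hf
  have h₂ : [b, c] <:+: l := List.IsInfix.trans ⟨[a], [], rfl⟩ hf
  rcases hl a (hf.subset (by simp)) with rfl | rfl <;>
  rcases hl b (hf.subset (by simp)) with rfl | rfl <;>
  rcases hl c (hf.subset (by simp)) with rfl | rfl <;>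
  first | contradiction | simp [hst, hst.symm]

theorem List.count_le_of_avoid (hst : s ≠ t) (l : List B) (hl : ∀ b ∈ l, b = s ∨ b = t)
    (ht : ¬ [t, t, t] <:+: l) : l.count t ≤ 2 * l.count s + 2 := by
  match l with
  | [] => simp
  | [a] => exact List.count_le_length.trans (by simp)
  | [a, b] => exact List.count_le_length.trans (by simp)
  | a :: b :: c :: l =>
    have ih := List.count_le_of_avoid hst l (fun b hb => hl b (by simp [hb])) fun h =>
      ht (h.trans ⟨[a, b, c], [], by simp⟩)
    have h₁ := List.count_add_count_of_forall hst (l := [a, b, c])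
      fun b hb => hl b (by simp only [List.mem_cons] at hb ⊢; tauto)
    have h₂ : 0 < [a, b, c].count s := by
      rw [List.count_pos_iff]
      by_contra hno
      have hmem : ∀ x ∈ [a, b, c], x = t := fun x hx =>
        (hl x (by simp only [List.mem_cons] at hx ⊢; tauto)).resolve_left fun h => hno (h ▸ hx)
      obtain rfl := hmem a (by simp)
      obtain rfl := hmem b (by simp)
      obtain rfl := hmem c (by simp)
      exact ht ⟨[], l, by simp⟩
    have h₃ : ∀ x, (a :: b :: c :: l).count x = [a, b, c].count x + l.count x := fun x => by
      rw [← List.count_append]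
      rfl
    have h₄ : [a, b, c].length = 3 := rfl
    rw [h₃, h₃]
    omega

end Patterns

section AffineB

variable {n : ℕ} {w : List (Fin (n + 2))}

/-- The letter of `w` at the position `k`, as a natural number, with the value `n + 2` when `k`
is not a position of `w`. -/
def letterAt (w : List (Fin (n + 2))) (k : ℤ) : ℕ :=
  if 0 ≤ k then (w[k.toNat]?.map Fin.val).getD (n + 2) else n + 2

theorem letterAt_of_getElem? {m : ℕ} {s : Fin (n + 2)} (h : w[m]? = some s) :
    letterAt w m = s := by
  simp [letterAt, h]

theorem exists_getElem?_of_letterAt {k : ℤ} {v : ℕ} (h : letterAt w k = v) (hv : v ≤ n + 1) :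
    ∃ m : ℕ, k = m ∧ ∃ s : Fin (n + 2), w[m]? = some s ∧ (s : ℕ) = v := by
  rw [letterAt] at h
  split_ifs at h with hk
  · refine ⟨k.toNat, by omega, ?_⟩
    rcases hw : w[k.toNat]? with _ | s
    · rw [hw] at h
      simp at h
      omega
    · rw [hw] at h
      exact ⟨s, rfl, by simpa using h⟩
  · omega

theorem letterAt_append_cons (u v r : List (Fin (n + 2))) (a b : Fin (n + 2)) :
    letterAt (u ++ a :: (v ++ b :: r)) u.length = a ∧
    letterAt (u ++ a :: (v ++ b :: r)) (u.length + v.length + 1 : ℕ) = b ∧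
    ∀ k : ℤ, u.length < k → k < (u.length + v.length + 1 : ℕ) →
      ∃ c ∈ v, letterAt (u ++ a :: (v ++ b :: r)) k = c := by
  refine ⟨letterAt_of_getElem? (by simp), letterAt_of_getElem? ?_, fun k hk hk' => ?_⟩
  · rw [List.getElem?_append_right (by omega), show u.length + v.length + 1 - u.length =
      v.length + 1 by omega, List.getElem?_cons_succ, List.getElem?_append_right le_rfl]
    simp
  · obtain ⟨m, rfl⟩ : ∃ m : ℕ, k = (u.length + m + 1 : ℕ) :=
      ⟨(k - u.length - 1).toNat, by omega⟩
    have hm : m < v.length := by omega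
    refine ⟨v[m], List.getElem_mem hm, letterAt_of_getElem? ?_⟩
    rw [List.getElem?_append_right (by omega), show u.length + m + 1 - u.length =
      m + 1 by omega, List.getElem?_cons_succ, List.getElem?_append_left hm,
      List.getElem?_eq_getElem hm]

theorem exists_letterAt_pair {s t a b : Fin (n + 2)} (h : [a, b] <:+: pairFilter s t w) :
    ∃ x y : ℤ, x < y ∧ letterAt w x = a ∧ letterAt w y = b ∧
      ∀ k, x < k → k < y → letterAt w k ≠ s ∧ letterAt w k ≠ t := by
  obtain ⟨u, v, r, rfl, hv⟩ := List.exists_of_infix_filter h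
  obtain ⟨h₁, h₂, h₃⟩ := letterAt_append_cons u v r a b
  refine ⟨_, _, by push_cast; omega, h₁, h₂, fun k hk hk' => ?_⟩
  obtain ⟨c, hc, hck⟩ := h₃ k hk hk'
  simpa [hck, Fin.ext_iff] using hv c hc

theorem exists_letterAt_triple {s t a b c : Fin (n + 2)}
    (h : [a, b, c] <:+: pairFilter s t w) :
    ∃ x y z : ℤ, x < y ∧ y < z ∧ letterAt w x = a ∧ letterAt w y = b ∧ letterAt w z = c ∧
      ∀ k, x < k → k < z → k ≠ y → letterAt w k ≠ s ∧ letterAt w k ≠ t := by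
  obtain ⟨u, v, v', r, rfl, hv, hv'⟩ := List.exists_of_infix_filter_three h
  obtain ⟨h₁, h₂, h₃⟩ := letterAt_append_cons u v (v' ++ c :: r) a b
  obtain ⟨h₄, h₅, h₆⟩ := letterAt_append_cons (u ++ a :: v) v' r b c
  rw [show u ++ a :: v ++ b :: (v' ++ c :: r) = u ++ a :: (v ++ b :: (v' ++ c :: r)) by simp]
    at h₄ h₅ h₆
  have hlen : (u ++ a :: v).length = u.length + v.length + 1 := by simp; omega
  rw [hlen] at h₅ h₆
  refine ⟨_, _, _, by push_cast; omega, by push_cast; omega, h₁, h₂, h₅, fun k hk hk' hne => ?_⟩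
  rcases lt_or_gt_of_ne hne with hlt | hlt
  · obtain ⟨d, hd, hdk⟩ := h₃ k hk hlt
    simpa [hdk, Fin.ext_iff] using hv d hd
  · obtain ⟨d, hd, hdk⟩ := h₆ k hlt hk'
    simpa [hdk, Fin.ext_iff] using hv' d hd

theorem affineB_apply (n : ℕ) (i j : Fin (n + 2)) : affineB n i j =
    if (i : ℕ) = (j : ℕ) then 1
    else if ((i : ℕ) = 0 ∧ (j : ℕ) = 1) ∨ ((j : ℕ) = 0 ∧ (i : ℕ) = 1) then 4
    else if ((i : ℕ) + 1 = (j : ℕ) ∧ (j : ℕ) ≤ n) ∨ ((j : ℕ) + 1 = (i : ℕ) ∧ (i : ℕ) ≤ n)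
        ∨ ((i : ℕ) + 2 = n + 1 ∧ (j : ℕ) = n + 1)
        ∨ ((j : ℕ) + 2 = n + 1 ∧ (i : ℕ) = n + 1) then 3
    else 2 := rfl

theorem affineB_eq_two {s t : Fin (n + 2)} (hs : 1 ≤ (s : ℕ)) (hsn : (s : ℕ) + 1 ≤ n)
    (hst : (t : ℕ) ≠ s) (hl : (t : ℕ) + 1 ≠ s) (hr : ¬ IsRightNeighbor n s t) :
    affineB n s t = 2 := by
  rw [IsRightNeighbor] at hr
  rw [affineB_apply]
  split_ifs <;> omega

theorem affineB_eq_three {s t : Fin (n + 2)} (hs : 1 ≤ (s : ℕ)) (hsn : (s : ℕ) + 1 ≤ n)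
    (h : (t : ℕ) + 1 = s ∨ IsRightNeighbor n s t) (h0 : (t : ℕ) ≠ 0) :
    affineB n s t = 3 := by
  rw [IsRightNeighbor] at h
  rw [affineB_apply]
  split_ifs <;> omega

theorem isAlternatingHeap_letterAt {W : Type*} [Group W] {cs : CoxeterSystem (affineB n) W}
    (hn : 2 ≤ n) (hw : cs.IsReduced w) (hfc : IsFullyCommutative cs (cs.wordProd w)) :
    IsAlternatingHeap n (letterAt w) where
  path {i x y} hi hin hxy hx hy hgap := by
    obtain ⟨x, rfl, s, hs, hsi⟩ := exists_getElem?_of_letterAt hx (by omega)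
    obtain ⟨y, rfl, s', hs', hsi'⟩ := exists_getElem?_of_letterAt hy (by omega)
    obtain rfl : s = s' := Fin.ext (by omega)
    subst hsi
    rw [or_iff_not_imp_left]
    intro h0
    by_contra hno
    by_cases hex : ∃ z : ℤ, x < z ∧ z < y ∧
        (letterAt w z + 1 = s ∨ IsRightNeighbor n s (letterAt w z))
    · obtain ⟨z, hxz, hzy, hz⟩ := hex
      obtain ⟨z, rfl, t, ht, htz⟩ := exists_getElem?_of_letterAt (w := w) (k := z) rfl
        (by rcases hz with h | h | h <;> omega)
      rw [← htz] at hz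
      have ht0 : (t : ℕ) ≠ 0 := fun h => h0 ⟨by rcases hz with h' | h' | h' <;> omega, z, hxz, hzy,
        by omega⟩
      refine IsFullyCommutative.not_braid_three hw hfc (affineB_eq_three hi hin hz ht0)
        (by omega) (by omega) hs ht hs' fun k a hxk hky hkz hka => ?_
      have hak := letterAt_of_getElem? hka
      have hkn : ¬ ((a : ℕ) + 1 = s ∨ IsRightNeighbor n s a) := by
        intro ha
        rw [← hak] at ha
        rw [htz] at hz
        rcases lt_or_gt_of_ne hkz with hlt | hlt
        · exact hno ⟨k, z, by omega, by omega, hzy, ha, hz⟩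
        · exact hno ⟨z, k, hxz, by omega, by omega, hz, ha⟩
      rw [not_or] at hkn
      exact affineB_eq_two hi hin (hak ▸ hgap k (by omega) (by omega)) hkn.1 hkn.2
    · push Not at hex
      refine IsFullyCommutative.not_consecutive hw (x := x) (y := y) (by omega) hs hs'
        fun k a hxk hky hka => ?_
      have hak := letterAt_of_getElem? hka
      have := hex k (by omega) (by omega)
      rw [hak] at this
      exact affineB_eq_two hi hin (hak ▸ hgap k (by omega) (by omega)) this.1 this.2
  fork {v x y} hv hxy hx hy := by
    obtain ⟨y', hy', hxy', hx, hy, hgap⟩ := exists_isGap_right hxy hx hy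
    suffices h : ∃ z z', x < z ∧ z < z' ∧ z' < y' ∧ letterAt w z + 1 = n ∧
        letterAt w z' + 1 = n by
      obtain ⟨z, z', h₁, h₂, h₃, h₄⟩ := h
      exact ⟨z, z', h₁, h₂, by omega, h₄⟩
    obtain ⟨x, rfl, s, hs, hsi⟩ := exists_getElem?_of_letterAt hx (by omega)
    obtain ⟨y', rfl, s', hs', hsi'⟩ := exists_getElem?_of_letterAt hy (by omega)
    obtain rfl : s = s' := Fin.ext (by omega)
    have hcomm : ∀ a : Fin (n + 2), (a : ℕ) ≠ v → (a : ℕ) + 1 ≠ n → affineB n s a = 2 := by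
      intro a h₁ h₂
      rw [affineB_apply]
      split_ifs <;> omega
    by_contra hno
    by_cases hex : ∃ z : ℤ, x < z ∧ z < y' ∧ letterAt w z + 1 = n
    · obtain ⟨z, hxz, hzy, hz⟩ := hex
      obtain ⟨z, rfl, t, ht, htz⟩ := exists_getElem?_of_letterAt (w := w) (k := z) rfl (by omega)
      refine IsFullyCommutative.not_braid_three hw hfc (s := s) (t := t) ?_
        (by omega) (by omega) hs ht hs' fun k a hxk hky hkz hka => ?_
      · rw [affineB_apply]
        split_ifs <;> omega
      have hak := letterAt_of_getElem? hka
      refine hcomm a (hak ▸ hgap k (by omega) (by omega)) fun ha => ?_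
      rcases lt_or_gt_of_ne hkz with hlt | hlt
      · exact hno ⟨k, z, by omega, by omega, hzy, by omega, hz⟩
      · exact hno ⟨z, k, hxz, by omega, by omega, hz, by omega⟩
    · push Not at hex
      refine IsFullyCommutative.not_consecutive hw (x := x) (y := y') (by omega) hs hs'
        fun k a hxk hky hka => ?_
      have hak := letterAt_of_getElem? hka
      exact hcomm a (hak ▸ hgap k (by omega) (by omega)) (hak ▸ hex k (by omega) (by omega))
  zero {x y} hxy hx hy := by
    obtain ⟨y', hy', hxy', hx, hy, hgap⟩ := exists_isGap_right hxy hx hy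
    by_contra! hno
    obtain ⟨x, rfl, s, hs, hsi⟩ := exists_getElem?_of_letterAt hx (by omega)
    obtain ⟨y', rfl, s', hs', hsi'⟩ := exists_getElem?_of_letterAt hy (by omega)
    obtain rfl : s = s' := Fin.ext (by omega)
    refine IsFullyCommutative.not_consecutive hw (x := x) (y := y') (by omega) hs hs'
      fun k a hxk hky hka => ?_
    have hak := letterAt_of_getElem? hka
    have h₀ := hgap k (by omega) (by omega)
    have h₁ := hno k (by omega) (by omega)
    rw [affineB_apply]
    split_ifs <;> omega
  not_zero_one {x y z t} hxy hyz hzt hx hy hz ht h h' := by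
    obtain ⟨x, rfl, s, hs, hsi⟩ := exists_getElem?_of_letterAt hx (by omega)
    obtain ⟨y, rfl, r, hr, hri⟩ := exists_getElem?_of_letterAt hy (by omega)
    obtain ⟨z, rfl, s', hs', hsi'⟩ := exists_getElem?_of_letterAt hz (by omega)
    obtain ⟨t, rfl, r', hr', hri'⟩ := exists_getElem?_of_letterAt ht (by omega)
    obtain rfl : s = s' := Fin.ext (by omega)
    obtain rfl : r = r' := Fin.ext (by omega)
    refine IsFullyCommutative.not_braid_four hw hfc (s := s) (t := r) ?_ (by omega) (by omega)
      (by omega) hs hr hs' hr' (fun k a hxk hkz hky hka => ?_) fun k a hxk hkz hky hka => ?_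
    · rw [affineB_apply]
      split_ifs <;> omega
    · have hak := letterAt_of_getElem? hka
      obtain ⟨h₁, h₂⟩ := h k (by omega) (by omega) (by omega)
      rw [affineB_apply]
      split_ifs <;> omega
    · have hak := letterAt_of_getElem? hka
      obtain ⟨h₁, h₂, h₃⟩ := h' k (by omega) (by omega) (by omega)
      rw [hak, ← hri] at h₃
      exact affineB_eq_two (by omega) (by omega) (by omega) (by omega) h₃
  not_one_zero {x y z t} hxy hyz hzt hx hy hz ht h h' := by
    obtain ⟨x, rfl, s, hs, hsi⟩ := exists_getElem?_of_letterAt hx (by omega)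
    obtain ⟨y, rfl, r, hr, hri⟩ := exists_getElem?_of_letterAt hy (by omega)
    obtain ⟨z, rfl, s', hs', hsi'⟩ := exists_getElem?_of_letterAt hz (by omega)
    obtain ⟨t, rfl, r', hr', hri'⟩ := exists_getElem?_of_letterAt ht (by omega)
    obtain rfl : s = s' := Fin.ext (by omega)
    obtain rfl : r = r' := Fin.ext (by omega)
    refine IsFullyCommutative.not_braid_four hw hfc (s := s) (t := r) ?_ (by omega) (by omega)
      (by omega) hs hr hs' hr' (fun k a hxk hkz hky hka => ?_) fun k a hxk hkz hky hka => ?_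
    · rw [affineB_apply]
      split_ifs <;> omega
    · have hak := letterAt_of_getElem? hka
      obtain ⟨h₁, h₂, h₃⟩ := h k (by omega) (by omega) (by omega)
      rw [hak, ← hsi] at h₃
      exact affineB_eq_two (by omega) (by omega) (by omega) (by omega) h₃
    · have hak := letterAt_of_getElem? hka
      obtain ⟨h₁, h₂⟩ := h' k (by omega) (by omega) (by omega)
      rw [affineB_apply]
      split_ifs <;> omega

theorem exists_isGap_of_count {s : Fin (n + 2)} (h : 3 ≤ w.count s) :
    ∃ x y z, IsGap (letterAt w) s x y ∧ IsGap (letterAt w) s y z := by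
  have hall : ∀ b ∈ pairFilter s s w, b = s := fun b hb => by
    simpa using forall_mem_pairFilter s s w b hb
  have hlen : 3 ≤ (pairFilter s s w).length := by
    rw [← count_pairFilter_left s s w] at h
    exact h.trans List.count_le_length
  have hinf : [s, s, s] <:+: pairFilter s s w := by
    rw [List.eq_replicate_of_mem hall]
    refine ⟨[], List.replicate ((pairFilter s s w).length - 3) s, ?_⟩
    rw [show [s, s, s] = List.replicate 3 s from rfl, List.nil_append,
      List.replicate_append_replicate, Nat.add_sub_cancel' hlen]
  obtain ⟨x, y, z, hxy, hyz, hx, hy, hz, hno⟩ := exists_letterAt_triple hinf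
  exact ⟨x, y, z, ⟨hxy, hx, hy, fun k hk hk' => (hno k hk (hk'.trans hyz) hk'.ne).1⟩,
    hyz, hy, hz, fun k hk hk' => (hno k (hxy.trans hk) hk' hk.ne').1⟩

theorem lt_cases_of_affineB_ne_two (hn : 2 ≤ n) {s t : Fin (n + 2)} (hlt : (s : ℕ) < t)
    (hst : affineB n s t ≠ 2) : ((s : ℕ) = 0 ∧ (t : ℕ) = 1) ∨
      (1 ≤ (s : ℕ) ∧ (s : ℕ) + 2 ≤ n ∧ (t : ℕ) = s + 1) ∨
      ((s : ℕ) = n - 1 ∧ ((t : ℕ) = n ∨ (t : ℕ) = n + 1)) := by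
  rw [affineB_apply] at hst
  split_ifs at hst <;> omega

theorem isWindowed_affineB_of_lt {c : Fin (n + 2) → ℕ}
    (h : ∀ s t : Fin (n + 2), (s : ℕ) < t → affineB n s t ≠ 2 →
      HasUniformWindows (pairFilter s t w) s (c s + c t) (c s)) : IsWindowed (affineB n) c w := by
  intro s t hst hM
  rcases lt_or_gt_of_ne fun e : (s : ℕ) = t => hst (Fin.ext e) with hlt | hlt
  · exact h s t hlt hM
  · have hcomm : pairFilter s t w = pairFilter t s w :=
      List.filter_congr fun b _ => by simp only [or_comm]
    rw [hcomm]
    exact (h t s hlt ((affineB n).symmetric s t ▸ hM)).swap hst.symm (forall_mem_pairFilter t s w)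

namespace IsAlternatingHeap

variable {s t : Fin (n + 2)}

theorem avoid_fork (hf : IsAlternatingHeap n (letterAt w)) (ht : (t : ℕ) = n ∨ (t : ℕ) = n + 1)
    (hs : (s : ℕ) + 1 = n) : ¬ [t, t] <:+: pairFilter s t w := by
  intro h
  obtain ⟨x, y, hxy, hx, hy, hno⟩ := exists_letterAt_pair h
  obtain ⟨z, z', h₁, h₂, h₃, h₄, -⟩ := hf.fork ht hxy hx hy
  exact (hno z h₁ (h₂.trans h₃)).1 (by omega)

theorem avoid_single_fork (hf : IsAlternatingHeap n (letterAt w))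
    (ht : (t : ℕ) = n ∨ (t : ℕ) = n + 1) (hs : (s : ℕ) + 1 = n) :
    ¬ [t, s, t] <:+: pairFilter s t w := by
  intro h
  obtain ⟨x, y, z, hxy, hyz, hx, hy, hz, hno⟩ := exists_letterAt_triple h
  exact hf.not_single_fork ht (hxy.trans hyz) hx hz fun k hk hk' hne => by
    have := (hno k hk hk' hne).1
    omega

theorem avoid_zero (hf : IsAlternatingHeap n (letterAt w)) (hs : (s : ℕ) = 0) (ht : (t : ℕ) = 1) :
    ¬ [s, s] <:+: pairFilter s t w := by
  intro h
  obtain ⟨x, y, hxy, hx, hy, hno⟩ := exists_letterAt_pair h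
  obtain ⟨z, h₁, h₂, h₃⟩ := hf.zero hxy (hs ▸ hx) (hs ▸ hy)
  exact (hno z h₁ h₂).2 (by omega)

theorem avoid_three_right (hf : IsAlternatingHeap n (letterAt w)) (hs : 1 ≤ (s : ℕ))
    (hsn : (s : ℕ) + 2 ≤ n) (hst : (t : ℕ) = s + 1) : ¬ [s, s, s] <:+: pairFilter s t w := by
  intro h
  obtain ⟨x, y, z, hxy, hyz, hx, hy, hz, hno⟩ := exists_letterAt_triple h
  refine hf.not_two_gaps_of_right hs (by omega)
    ⟨hxy, hx, hy, fun k hk hk' => (hno k hk (hk'.trans hyz) hk'.ne).1⟩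
    ⟨hyz, hy, hz, fun k hk hk' => (hno k (hxy.trans hk) hk' hk.ne').1⟩ fun k hk hk' hne hR => ?_
  have := (hno k hk hk' hne).2
  rcases hR with h | h <;> omega

theorem avoid_three_left (hf : IsAlternatingHeap n (letterAt w)) (htn : (t : ℕ) + 1 ≤ n)
    (hst : (t : ℕ) = s + 1) : ¬ [t, t, t] <:+: pairFilter s t w := by
  intro h
  obtain ⟨x, y, z, hxy, hyz, hx, hy, hz, hno⟩ := exists_letterAt_triple h
  refine hf.not_two_gaps_of_left (by omega) htn
    ⟨hxy, hx, hy, fun k hk hk' => (hno k hk (hk'.trans hyz) hk'.ne).2⟩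
    ⟨hyz, hy, hz, fun k hk hk' => (hno k (hxy.trans hk) hk' hk.ne').2⟩ fun k hk hk' hne hL => ?_
  have := (hno k hk hk' hne).1
  omega

theorem avoid_three_fork (hf : IsAlternatingHeap n (letterAt w)) (hn : 2 ≤ n)
    (ht : (t : ℕ) = n ∨ (t : ℕ) = n + 1) (hs : (s : ℕ) = n - 1) :
    ¬ [s, s, s] <:+: pairFilter s t w := by
  intro h
  obtain ⟨x, y, z, hxy, hyz, hx, hy, hz, hno⟩ := exists_letterAt_triple h
  rw [hs] at hx hy hz hno
  exact hf.not_two_gaps_of_fork hn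
    ⟨hxy, hx, hy, fun k hk hk' => (hno k hk (hk'.trans hyz) hk'.ne).1⟩
    ⟨hyz, hy, hz, fun k hk hk' => (hno k (hxy.trans hk) hk' hk.ne').1⟩ ht
    fun k hk hk' hne => (hno k hk hk' hne).2

theorem hasUniformWindows_fork (hf : IsAlternatingHeap n (letterAt w)) (hn : 2 ≤ n)
    (ht : (t : ℕ) = n ∨ (t : ℕ) = n + 1) (hs : (s : ℕ) = n - 1) :
    HasUniformWindows (pairFilter s t w) s (2 + 1) 2 := by
  have hst : t ≠ s := fun h => by rw [h] at ht; omega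
  have hmem : ∀ b ∈ pairFilter s t w, b = t ∨ b = s := fun b hb =>
    (forall_mem_pairFilter s t w b hb).symm
  exact (HasUniformWindows.one_of_avoid hst hmem (hf.avoid_fork ht (by omega))
    (hf.avoid_single_fork ht (by omega)) (hf.avoid_three_fork hn ht hs)).swap hst hmem

theorem not_infix_pair (h : ∀ x y, IsGap (letterAt w) s x y →
    ∃ z, x < z ∧ z < y ∧ letterAt w z = t) :
    ¬ [s, s] <:+: pairFilter s t w ∧ ¬ [s, s] <:+: pairFilter t s w := by
  refine ⟨fun h' => ?_, fun h' => ?_⟩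
  · obtain ⟨x, y, hxy, hx, hy, hno⟩ := exists_letterAt_pair h'
    obtain ⟨z, h₁, h₂, h₃⟩ := h x y ⟨hxy, hx, hy, fun k hk hk' => (hno k hk hk').1⟩
    exact (hno z h₁ h₂).2 h₃
  · obtain ⟨x, y, hxy, hx, hy, hno⟩ := exists_letterAt_pair h'
    obtain ⟨z, h₁, h₂, h₃⟩ := h x y ⟨hxy, hx, hy, fun k hk hk' => (hno k hk hk').2⟩
    exact (hno z h₁ h₂).1 h₃

end IsAlternatingHeap

/-- The number of occurrences of each letter in a period of an alternating word. -/
def alternatingWeight (n : ℕ) (s : Fin (n + 2)) : ℕ := if n ≤ (s : ℕ) then 1 else 2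

/-- The number of occurrences of each letter in a period of a zigzag word. -/
def zigzagWeight (n : ℕ) (s : Fin (n + 2)) : ℕ := if (s : ℕ) = 0 ∨ n ≤ (s : ℕ) then 1 else 2

namespace IsAlternatingHeap

theorem isWindowed_alternatingWeight (hf : IsAlternatingHeap n (letterAt w)) (hn : 2 ≤ n)
    (h : ∀ i x y, 1 ≤ i → i + 1 ≤ n → IsGap (letterAt w) i x y →
      ¬ IsLeftGap n (letterAt w) i x y ∧ ¬ IsRightGap (letterAt w) i x y) :
    IsWindowed (affineB n) (alternatingWeight n) w := by
  refine isWindowed_affineB_of_lt fun s t hlt hM => ?_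
  have hst : s ≠ t := fun h => hlt.ne (congrArg Fin.val h)
  have hmem := forall_mem_pairFilter s t w
  rcases lt_cases_of_affineB_ne_two hn hlt hM with ⟨hs, ht⟩ | ⟨hs, hsn, ht⟩ | ⟨hs, ht⟩
  · have e₁ : alternatingWeight n s = 2 := if_neg (by omega)
    have e₂ : alternatingWeight n t = 2 := if_neg (by omega)
    rw [e₁, e₂]
    refine .two_of_avoid hst hmem (hf.avoid_zero hs ht) (not_infix_pair fun x y hxy => ?_).2
    obtain ⟨z, h₁, h₂, h₃⟩ := exists_left_of_not_isRightGap hxy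
      (h _ x y (by omega) (by omega) hxy).2
    exact ⟨z, h₁, h₂, by omega⟩
  · have e₁ : alternatingWeight n s = 2 := if_neg (by omega)
    have e₂ : alternatingWeight n t = 2 := if_neg (by omega)
    rw [e₁, e₂]
    refine .two_of_avoid hst hmem (not_infix_pair fun x y hxy => ?_).1
      (not_infix_pair fun x y hxy => ?_).2
    · obtain ⟨z, h₁, h₂, h₃⟩ := exists_right_of_not_isLeftGap hxy
        (h _ x y (by omega) (by omega) hxy).1
      exact ⟨z, h₁, h₂, by rcases h₃ with h | h <;> omega⟩
    · obtain ⟨z, h₁, h₂, h₃⟩ := exists_left_of_not_isRightGap hxy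
        (h _ x y (by omega) (by omega) hxy).2
      exact ⟨z, h₁, h₂, by omega⟩
  · have e₁ : alternatingWeight n s = 2 := if_neg (by omega)
    have e₂ : alternatingWeight n t = 1 := if_pos (by omega)
    rw [e₁, e₂]
    exact hf.hasUniformWindows_fork hn ht hs

theorem isWindowed_zigzagWeight (hf : IsAlternatingHeap n (letterAt w)) (hn : 2 ≤ n)
    (hcount : ∀ s : Fin (n + 2), 1 ≤ (s : ℕ) → (s : ℕ) + 1 ≤ n → 3 ≤ w.count s)
    (h : ∀ i x y, 1 ≤ i → i + 1 ≤ n → IsGap (letterAt w) i x y →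
      IsLeftGap n (letterAt w) i x y ∨ IsRightGap (letterAt w) i x y) :
    IsWindowed (affineB n) (zigzagWeight n) w := by
  refine isWindowed_affineB_of_lt fun s t hlt hM => ?_
  have hst : s ≠ t := fun h => hlt.ne (congrArg Fin.val h)
  have hmem := forall_mem_pairFilter s t w
  rcases lt_cases_of_affineB_ne_two hn hlt hM with ⟨hs, ht⟩ | ⟨hs, hsn, ht⟩ | ⟨hs, ht⟩
  · have e₁ : zigzagWeight n s = 1 := if_pos (by omega)
    have e₂ : zigzagWeight n t = 2 := if_neg (by omega)
    rw [e₁, e₂]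
    refine .one_of_avoid hst hmem (hf.avoid_zero hs ht) (fun h' => ?_)
      (hf.avoid_three_left (by omega) (by omega))
    obtain ⟨x, y, z, hxy, hyz, hx, hy, hz, hno⟩ := exists_letterAt_triple h'
    obtain ⟨a, b, -, ⟨hab, ha, hb, -⟩, -⟩ :=
      exists_isGap_of_count (hcount t (by omega) (by omega))
    rw [hs] at hx hz
    rw [ht] at hy ha hb hno
    refine hf.not_single_one hn (fun x y => h 1 x y le_rfl hn) ?_ hxy hyz hx hy hz
      fun k hk hk' hne => (hno k hk hk' hne).2
    by_cases hay : a = y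
    · exact ⟨b, hb, by omega⟩
    · exact ⟨a, ha, hay⟩
  · have e₁ : zigzagWeight n s = 2 := if_neg (by omega)
    have e₂ : zigzagWeight n t = 2 := if_neg (by omega)
    rw [e₁, e₂]
    refine .two_of_avoid_three hst hmem (hf.avoid_three_right hs hsn ht)
      (hf.avoid_three_left (by omega) ht) (fun h' => ?_) fun h' => ?_
    · obtain ⟨x, y, z, hxy, hyz, hx, hy, hz, hno⟩ := exists_letterAt_triple h'
      rw [ht] at hy hno
      refine hf.not_single_right hs hsn (h _ x z hs (by omega) ⟨hxy.trans hyz, hx, hz,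
        fun k hk hk' => ?_⟩) hxy hyz hy fun k hk hk' hne => (hno k hk hk' hne).2
      by_cases hne : k = y
      · rw [hne, hy]
        omega
      · exact (hno k hk hk' hne).1
    · obtain ⟨x, y, z, hxy, hyz, hx, hy, hz, hno⟩ := exists_letterAt_triple h'
      rw [ht] at hx hz hno
      refine hf.not_single_left hs hsn (h _ x z (by omega) (by omega) ⟨hxy.trans hyz, hx, hz,
        fun k hk hk' => ?_⟩) hxy hyz hy fun k hk hk' hne => (hno k hk hk' hne).1
      by_cases hne : k = y
      · rw [hne, hy]
        omega
      · exact (hno k hk hk' hne).2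
  · have e₁ : zigzagWeight n s = 2 := if_neg (by omega)
    have e₂ : zigzagWeight n t = 1 := if_pos (by omega)
    rw [e₁, e₂]
    exact hf.hasUniformWindows_fork hn ht hs

theorem count_le (hf : IsAlternatingHeap n (letterAt w)) {s t : Fin (n + 2)} (hs : 1 ≤ (s : ℕ))
    (hsn : (s : ℕ) + 1 ≤ n) (ht : (t : ℕ) + 1 = s ∨ IsRightNeighbor n s t) :
    w.count t ≤ 2 * w.count s + 2 := by
  have hst : s ≠ t := by
    rintro rfl
    rcases ht with h | h | h <;> omega
  have hpre : [t, t] <:+: [t, t, t] := ⟨[], [t], rfl⟩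
  have hcomm : pairFilter s t w = pairFilter t s w :=
    List.filter_congr fun b _ => by simp only [or_comm]
  rw [← count_pairFilter_left s t w, ← count_pairFilter_right s t w]
  refine List.count_le_of_avoid hst _ (forall_mem_pairFilter s t w) ?_
  rcases ht with ht | ht
  · rw [hcomm]
    by_cases h0 : (t : ℕ) = 0
    · exact fun h => hf.avoid_zero h0 (by omega) (hpre.trans h)
    · exact hf.avoid_three_right (by omega) (by omega) (by omega)
  · by_cases htn : (t : ℕ) + 1 ≤ n
    · exact hf.avoid_three_left htn (by rcases ht with h | h <;> omega)
    · exact fun h => hf.avoid_fork (by rcases ht with h | h <;> omega)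
        (by rcases ht with h | h <;> omega) (hpre.trans h)

end IsAlternatingHeap

theorem le_two_pow_mul_of_neighbor {g : ℕ → ℕ} (hn : 2 ≤ n)
    (hg : ∀ i j, 1 ≤ i → i + 1 ≤ n → j + 1 = i ∨ IsRightNeighbor n i j → g j ≤ 2 * g i + 2)
    {i j : ℕ} (hi : 1 ≤ i) (hin : i + 1 ≤ n) (hj : j ≤ n + 1) : g j + 2 ≤ 2 ^ n * (g i + 2) := by
  have hup : ∀ m, i + m ≤ n → g (i + m) + 2 ≤ 2 ^ m * (g i + 2) := by
    intro m
    induction m with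
    | zero => simp
    | succ m ih =>
      intro hm
      have h₁ := ih (by omega)
      have h₂ := hg (i + m) (i + (m + 1)) (by omega) (by omega) (.inr (.inl rfl))
      rw [pow_succ]
      linarith
  have hdown : ∀ m j, j + m = i → g j + 2 ≤ 2 ^ m * (g i + 2) := by
    intro m
    induction m with
    | zero =>
      rintro j rfl
      simp
    | succ m ih =>
      intro j hj
      have h₁ := ih (j + 1) (by omega)
      have h₂ := hg (j + 1) j (by omega) (by omega) (.inl rfl)
      rw [pow_succ]
      linarith
  have hmono : ∀ m, m ≤ n → 2 ^ m * (g i + 2) ≤ 2 ^ n * (g i + 2) := fun m hm =>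
    Nat.mul_le_mul_right _ (Nat.pow_le_pow_right two_pos hm)
  rcases le_or_gt j i with hle | hlt
  · exact (hdown (i - j) j (by omega)).trans (hmono _ (by omega))
  · rcases Nat.le_or_eq_of_le_succ hj with hjn | rfl
    · obtain ⟨m, rfl⟩ := Nat.exists_eq_add_of_lt hlt
      exact (hup (m + 1) hjn).trans (hmono _ (by omega))
    · obtain ⟨m, hm⟩ : ∃ m, i + m = n - 1 := ⟨n - 1 - i, by omega⟩
      have h₁ := hup m (by omega)
      have h₂ := hg (i + m) (n + 1) (by omega) (by omega) (.inr (.inr ⟨by omega, rfl⟩))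
      refine le_trans ?_ (hmono (m + 1) (by omega))
      rw [pow_succ]
      linarith

theorem IsAlternatingHeap.lt_count (hf : IsAlternatingHeap n (letterAt w)) (hn : 2 ≤ n) {m : ℕ}
    (hlen : (n + 2) * (2 ^ n * (m + 2)) < w.length) {s : Fin (n + 2)} (hs : 1 ≤ (s : ℕ))
    (hsn : (s : ℕ) + 1 ≤ n) : m < w.count s := by
  by_contra! hle
  set g : ℕ → ℕ := fun v => if h : v < n + 2 then w.count ⟨v, h⟩ else 0 with hg
  have hgs : ∀ t : Fin (n + 2), g t = w.count t := fun t => dif_pos t.2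
  have hcount : ∀ t : Fin (n + 2), w.count t ≤ 2 ^ n * (m + 2) := by
    intro t
    have := le_two_pow_mul_of_neighbor (g := g) (i := s) (j := t) hn (fun i j hi hin hij => by
      have hj : j < n + 2 := by rcases hij with h | h | h <;> omega
      have := hf.count_le (s := ⟨i, by omega⟩) (t := ⟨j, hj⟩) hi hin hij
      rwa [← hgs, ← hgs] at this) hs hsn (by omega)
    rw [hgs, hgs] at this
    have h₂ := Nat.mul_le_mul_left (2 ^ n) (Nat.add_le_add_right hle 2)
    omega
  have hcard : ∑ t, w.count t = w.length := by
    simpa using Multiset.sum_count_eq_card (s := (Finset.univ : Finset (Fin (n + 2))))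
      (m := (w : Multiset (Fin (n + 2)))) fun _ _ => Finset.mem_univ _
  have := Finset.sum_le_card_nsmul Finset.univ (fun t => w.count t) _ fun t _ => hcount t
  rw [hcard, Finset.card_univ, Fintype.card_fin, smul_eq_mul] at this
  omega

theorem IsAlternatingHeap.lt_length_pairFilter (hf : IsAlternatingHeap n (letterAt w)) (hn : 2 ≤ n)
    {m : ℕ} (hlen : (n + 2) * (2 ^ n * (m + 2)) < w.length) {s t : Fin (n + 2)} (hst : s ≠ t)
    (hM : affineB n s t ≠ 2) : m < (pairFilter s t w).length := by
  have h : (1 ≤ (s : ℕ) ∧ (s : ℕ) + 1 ≤ n) ∨ (1 ≤ (t : ℕ) ∧ (t : ℕ) + 1 ≤ n) := by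
    rcases lt_or_gt_of_ne fun e : (s : ℕ) = t => hst (Fin.ext e) with hlt | hlt
    · have := lt_cases_of_affineB_ne_two hn hlt hM
      omega
    · have := lt_cases_of_affineB_ne_two hn hlt ((affineB n).symmetric s t ▸ hM)
      omega
  rcases h with ⟨hs, hsn⟩ | ⟨ht, htn⟩
  · refine (hf.lt_count hn hlen hs hsn).trans_le ?_
    rw [← count_pairFilter_left s t w]
    exact List.count_le_length
  · refine (hf.lt_count hn hlen ht htn).trans_le ?_
    rw [← count_pairFilter_right s t w]
    exact List.count_le_length

theorem IsAlternatingHeap.isWindowed (hf : IsAlternatingHeap n (letterAt w)) (hn : 2 ≤ n)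
    (hlen : (n + 2) * (2 ^ n * 13) < w.length) :
    IsWindowed (affineB n) (alternatingWeight n) w ∨ IsWindowed (affineB n) (zigzagWeight n) w := by
  have hcount : ∀ s : Fin (n + 2), 1 ≤ (s : ℕ) → (s : ℕ) + 1 ≤ n → 3 ≤ w.count s :=
    fun s hs hsn => by
      have := hf.lt_count (m := 11) hn hlen hs hsn
      omega
  refine (hf.dichotomy fun i hi hin => ?_).imp (hf.isWindowed_alternatingWeight hn)
    (hf.isWindowed_zigzagWeight hn hcount)
  exact exists_isGap_of_count (hcount ⟨i, by omega⟩ hi hin)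

end AffineB

section Periodicity

variable {n : ℕ} {W : Type*} [Group W] (cs : CoxeterSystem (affineB n) W)

theorem exists_affineB_ne_two (hn : 2 ≤ n) (s : Fin (n + 2)) : ∃ t, s ≠ t ∧ affineB n s t ≠ 2 := by
  rcases lt_or_ge (s : ℕ) n with hlt | hge
  · refine ⟨⟨s + 1, by omega⟩, fun h => by simpa using congrArg Fin.val h, ?_⟩
    rw [affineB_apply]
    dsimp only
    split_ifs <;> omega
  · refine ⟨⟨n - 1, by omega⟩, fun h => ?_, ?_⟩
    · have : (s : ℕ) = n - 1 := congrArg Fin.val h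
      omega
    · rw [affineB_apply]
      dsimp only
      split_ifs <;> omega

theorem sum_alternatingWeight : ∑ s, alternatingWeight n s = 2 * n + 2 := by
  have h : ∀ i : Fin n, alternatingWeight n i.castSucc.castSucc = 2 := fun i =>
    if_neg (by simp)
  rw [Fin.sum_univ_castSucc, Fin.sum_univ_castSucc, Finset.sum_congr rfl fun i _ => h i]
  simp [alternatingWeight]
  omega

theorem sum_zigzagWeight (hn : 2 ≤ n) : ∑ s, zigzagWeight n s = 2 * n + 1 := by
  have h : ∀ s : Fin (n + 2),
      alternatingWeight n s = zigzagWeight n s + if s = 0 then 1 else 0 := by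
    intro s
    simp only [alternatingWeight, zigzagWeight, Fin.ext_iff, Fin.val_zero]
    split_ifs <;> omega
  have := sum_alternatingWeight (n := n)
  rw [Finset.sum_congr rfl fun s _ => h s, Finset.sum_add_distrib] at this
  simp at this
  omega

variable {cs}

theorem fcInvolutions_eq_union (hn : 2 ≤ n) {L : ℕ} (hL : (n + 2) * (2 ^ n * 13) < L) :
    fcInvolutions cs L = windowedFCInvolutions cs (alternatingWeight n) L ∪
      windowedFCInvolutions cs (zigzagWeight n) L := by
  refine Set.Subset.antisymm (fun g hg => ?_) (Set.union_subset (fun g hg => hg.1) fun g hg => hg.1)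
  obtain ⟨w, hw, rfl⟩ := cs.exists_isReduced g
  have hf := isAlternatingHeap_letterAt hn hw hg.1.1
  exact (hf.isWindowed hn (by rwa [← hw.eq, hg.2])).imp
    (fun h => ⟨hg, fun v hv hvw => (hg.1.1 w v hw rfl hv hvw).isWindowed h⟩)
    (fun h => ⟨hg, fun v hv hvw => (hg.1.1 w v hw rfl hv hvw).isWindowed h⟩)

theorem disjoint_windowedFCInvolutions (hn : 2 ≤ n) {L : ℕ} (hL : (n + 2) * (2 ^ n * 13) < L) :
    Disjoint (windowedFCInvolutions cs (alternatingWeight n) L)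
      (windowedFCInvolutions cs (zigzagWeight n) L) := by
  rw [Set.disjoint_left]
  rintro g ⟨hg, h₁⟩ ⟨-, h₂⟩
  obtain ⟨w, hw, rfl⟩ := cs.exists_isReduced g
  have hf := isAlternatingHeap_letterAt hn hw hg.1.1
  let s : Fin (n + 2) := ⟨0, by omega⟩
  let t : Fin (n + 2) := ⟨1, by omega⟩
  have hst : s ≠ t := by simp [s, t]
  have hM : affineB n s t ≠ 2 := by simp [affineB_apply, s, t]
  have hlen := hf.lt_length_pairFilter (m := 11) hn (by rwa [← hw.eq, hg.2]) hst hM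
  have e₁ : alternatingWeight n s = 2 := if_neg (by simp [s]; omega)
  have e₂ : alternatingWeight n t = 2 := if_neg (by simp [t]; omega)
  have e₃ : zigzagWeight n s = 1 := if_pos (by simp [s])
  have e₄ : zigzagWeight n t = 2 := if_neg (by simp [t]; omega)
  have h₃ := (h₁ w hw rfl s t hst hM).mul 3
  have h₄ := (h₂ w hw rfl s t hst hM).mul 4
  rw [e₁, e₂] at h₃
  rw [e₃, e₄] at h₄
  have hinf := (List.take_prefix 12 (pairFilter s t w)).isInfix
  have hlen' : ((pairFilter s t w).take 12).length = 12 := by rw [List.length_take]; omega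
  have h₅ := h₃ _ hinf hlen'
  have h₆ := h₄ _ hinf hlen'
  omega

theorem ncard_windowedFCInvolutions_affineB_le (hn : 2 ≤ n) {c : Fin (n + 2) → ℕ}
    (hc : ∀ s, c s ≤ 2) {L : ℕ} (hL : (n + 2) * (2 ^ n * 13) < L) :
    (windowedFCInvolutions cs c (L + ∑ s, c s)).ncard ≤ (windowedFCInvolutions cs c L).ncard := by
  refine ncard_windowedFCInvolutions_le cs (exists_affineB_ne_two hn) fun w hw hg s t hst hM => ?_
  have hlen := (isAlternatingHeap_letterAt hn hw hg.1.1).lt_length_pairFilter (m := 11) hn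
    (by rw [← hw.eq, hg.2]; exact hL.trans_le (Nat.le_add_right _ _)) hst hM
  have := hc s
  have := hc t
  omega

theorem ncard_fcInvolutions_affineB (hn : 2 ≤ n) {L : ℕ} (hL : (n + 2) * (2 ^ n * 13) < L) :
    (fcInvolutions cs L).ncard = (windowedFCInvolutions cs (alternatingWeight n) L).ncard +
      (windowedFCInvolutions cs (zigzagWeight n) L).ncard := by
  rw [fcInvolutions_eq_union hn hL]
  exact Set.ncard_union_eq (disjoint_windowedFCInvolutions hn hL)
    ((finite_fcInvolutions cs L).subset fun g hg => hg.1)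
    ((finite_fcInvolutions cs L).subset fun g hg => hg.1)

variable (cs) in
theorem exists_forall_ncard_fcInvolutions_eq (hn : 2 ≤ n) : ∃ N : ℕ, ∀ L, N ≤ L →
    (fcInvolutions cs (L + (2 * n + 1) * (2 * n + 2))).ncard = (fcInvolutions cs L).ncard := by
  have h₁ : ∀ L, (n + 2) * (2 ^ n * 13) + 1 ≤ L →
      (windowedFCInvolutions cs (alternatingWeight n) (L + (2 * n + 2))).ncard ≤
        (windowedFCInvolutions cs (alternatingWeight n) L).ncard := fun L hL => by
    rw [← sum_alternatingWeight]
    refine ncard_windowedFCInvolutions_affineB_le hn (fun s => ?_) hL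
    rw [alternatingWeight]
    split_ifs <;> omega
  have h₂ : ∀ L, (n + 2) * (2 ^ n * 13) + 1 ≤ L →
      (windowedFCInvolutions cs (zigzagWeight n) (L + (2 * n + 1))).ncard ≤
        (windowedFCInvolutions cs (zigzagWeight n) L).ncard := fun L hL => by
    rw [← sum_zigzagWeight hn]
    refine ncard_windowedFCInvolutions_affineB_le hn (fun s => ?_) hL
    rw [zigzagWeight]
    split_ifs <;> omega
  obtain ⟨N₁, hN₁⟩ := exists_forall_add_mul_eq_of_add_le
    (a := fun L => (windowedFCInvolutions cs (alternatingWeight n) L).ncard) (2 * n + 1) h₁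
  obtain ⟨N₂, hN₂⟩ := exists_forall_add_mul_eq_of_add_le
    (a := fun L => (windowedFCInvolutions cs (zigzagWeight n) L).ncard) (2 * n + 2) h₂
  refine ⟨max (max N₁ N₂) ((n + 2) * (2 ^ n * 13) + 1), fun L hL => ?_⟩
  simp only [max_le_iff] at hL
  have h₃ := hN₁ L hL.1.1
  have h₄ := hN₂ L hL.1.2
  rw [Nat.mul_comm (2 * n + 2)] at h₄
  rw [ncard_fcInvolutions_affineB hn (by omega), ncard_fcInvolutions_affineB hn (by omega), h₃, h₄]

end Periodicity

/-- For `n ≥ 2`, the number `a(L)` of fully commutative involutions of Coxeter length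
`L` in the affine Coxeter group of type `B̃_{n+1}` is ultimately periodic with period
dividing `(2n+1)(2n+2)`: there exists `N` such that `a(L + (2n+1)(2n+2)) = a(L)` for
all `L ≥ N`. -/
theorem ultimately_periodic_fcInvolutions_affineB (n : ℕ) (hn : 2 ≤ n) :
    ∃ N : ℕ, ∀ L : ℕ, N ≤ L →
      Nat.card {w : (affineB n).Group //
        IsFCInvolution (affineB n).toCoxeterSystem w ∧
        (affineB n).toCoxeterSystem.length w = L + (2 * n + 1) * (2 * n + 2)} =
      Nat.card {w : (affineB n).Group //
        IsFCInvolution (affineB n).toCoxeterSystem w ∧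
        (affineB n).toCoxeterSystem.length w = L} := by
  exact exists_forall_ncard_fcInvolutions_eq (affineB n).toCoxeterSystem hn
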